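/- arXiv:hep-th/9408143 — 5 statements merged into one kernel-verified Lean document; each statement's English description precedes it below -/
import Mathlib

section
/- For 0 < q < 1, Re(z) > 0 and Re(s) > 0, the q-Hurwitz zeta function admits the Euler–MacLaurin expansion ζ(s,z:q) = -( (q-q²)^s / (s log q) ) · F(s,s,s+1; q^z) + (1/2)((q-q²)/(1-q^z))^s + s((q-q²)/(1-q^z))^s Σ_{k=1}^m (B_{2k}/(2k)!) (log q/(q^z-1))^{2k-1} P_{2k-1}(q^z; s) - R_{2m}(s,z:q), where R_{2m}(s,z:q) = s ∫_0^∞ (B̄_{2m}(t)/(2m)!) (log q/(q^{t+z}-1))^{2m} ((1-q)/(1-q^{t+z}))^s q^{s(t+1)} P_{2m}(q^{t+z}; s) dt, F is the Gauss hypergeometric function, B_{2k} are Bernoulli numbers, and B̄_n(t) is the 1-periodic extension of the Bernoulli polynomial B_n(t) on [0,1). -/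
open MvPolynomial Complex MeasureTheory

/-- The polynomials `P_k(x;s)` (for `k ≥ 1`): `P₁ = 1`,
`P_{k+1} = (x - x²) ∂ₓ P_k + (k x + s) P_k`, with `X 0 = x`, `X 1 = s`. -/
noncomputable def Puq : ℕ → MvPolynomial (Fin 2) ℤ
  | 0 => 0
  | 1 => 1
  | (k + 2) =>
      (X 0 - X 0 ^ 2) * pderiv 0 (Puq (k + 1)) +
        (((k + 1 : ℕ) : MvPolynomial (Fin 2) ℤ) * X 0 + X 1) * Puq (k + 1)

/-- The Gauss hypergeometric function `₂F₁(α,β;γ;x)` as a power series. -/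
noncomputable def gaussHyp (α β γ x : ℂ) : ℂ :=
  ∑' n : ℕ, (Polynomial.eval α (ascPochhammer ℂ n) * Polynomial.eval β (ascPochhammer ℂ n) /
    (Polynomial.eval γ (ascPochhammer ℂ n) * (n.factorial : ℂ))) * x ^ n

/-- The 1-periodic extension `B̄_n(t) = B_n(t - ⌊t⌋)` of the Bernoulli polynomial. -/
noncomputable def perBernoulli (n : ℕ) (t : ℝ) : ℝ :=
  Polynomial.eval (Int.fract t) ((Polynomial.bernoulli n).map (algebraMap ℚ ℝ))

open Filter Topology

theorem perBernoulli_eq_bernoulliFun (n : ℕ) (t : ℝ) :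
    perBernoulli n t = bernoulliFun n (Int.fract t) := rfl

theorem measurable_perBernoulli (n : ℕ) : Measurable (perBernoulli n) :=
  (continuous_bernoulliFun n).measurable.comp measurable_fract

theorem exists_abs_perBernoulli_le (n : ℕ) : ∃ C, ∀ t, |perBernoulli n t| ≤ C := by
  obtain ⟨C, hC⟩ := (isCompact_Icc (a := (0 : ℝ)) (b := 1)).exists_bound_of_continuousOn
    (continuous_bernoulliFun n).continuousOn
  exact ⟨C, fun t => hC _ ⟨Int.fract_nonneg t, (Int.fract_lt_one t).le⟩⟩

theorem integrableOn_perBernoulli_mul {g : ℝ → ℂ} {S : Set ℝ} (hg : IntegrableOn g S) (n : ℕ) :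
    IntegrableOn (fun t => ((perBernoulli n t : ℂ) / (n.factorial : ℂ)) * g t) S := by
  obtain ⟨C, hC⟩ := exists_abs_perBernoulli_le n
  refine Integrable.bdd_mul (c := C / n.factorial) hg ?_ (Eventually.of_forall fun t => ?_)
  · exact ((Complex.measurable_ofReal.comp
      (measurable_perBernoulli n)).div_const _).aestronglyMeasurable
  · rw [norm_div, Complex.norm_natCast, Complex.norm_real]
    exact div_le_div_of_nonneg_right (hC t) (Nat.cast_nonneg _)

theorem integral_perBernoulli_mul_eq (n k : ℕ) (g : ℝ → ℂ) :
    ∫ t in (k : ℝ)..(k : ℝ) + 1, ((perBernoulli n t : ℂ) / (n.factorial : ℂ)) * g t =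
      ∫ t in (k : ℝ)..(k : ℝ) + 1, ((bernoulliFun n (t - k) : ℂ) / (n.factorial : ℂ)) * g t := by
  refine intervalIntegral.integral_congr_ae ?_
  have h : ∀ᵐ t : ℝ, t ≠ (k : ℝ) + 1 := by simp [ae_iff]
  filter_upwards [h] with t ht hmem
  rw [Set.uIoc_of_le (by linarith)] at hmem
  have hfl : Int.fract t = t - k := by
    rw [Int.fract_eq_iff]
    refine ⟨by linarith [hmem.1], ?_, k, by push_cast; ring⟩
    linarith [lt_of_le_of_ne hmem.2 ht]
  rw [perBernoulli_eq_bernoulliFun, hfl]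

/-- Integration by parts against a Bernoulli polynomial on `[k, k + 1]`. -/
theorem integral_perBernoulli_mul_unit (n k : ℕ) {g g' : ℝ → ℂ}
    (hg : ∀ t, 0 ≤ t → HasDerivAt g (g' t) t)
    (hg' : IntervalIntegrable g' volume k (k + 1)) :
    ∫ t in (k : ℝ)..(k : ℝ) + 1, ((perBernoulli n t : ℂ) / (n.factorial : ℂ)) * g t =
      ((bernoulliFun (n + 1) 1 : ℂ) * g (k + 1) - (bernoulliFun (n + 1) 0 : ℂ) * g k) /
          ((n + 1).factorial : ℂ) -
        ∫ t in (k : ℝ)..(k : ℝ) + 1,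
          ((perBernoulli (n + 1) t : ℂ) / ((n + 1).factorial : ℂ)) * g' t := by
  rw [integral_perBernoulli_mul_eq, integral_perBernoulli_mul_eq]
  have hfac : ((n + 1).factorial : ℂ) = (n + 1) * n.factorial := by
    push_cast [Nat.factorial_succ]; ring
  have hn : (n.factorial : ℂ) ≠ 0 := Nat.cast_ne_zero.mpr n.factorial_ne_zero
  have hn1 : (n + 1 : ℂ) ≠ 0 := Nat.cast_add_one_ne_zero n
  have hu : ∀ t : ℝ, HasDerivAt
      (fun t : ℝ => (bernoulliFun (n + 1) (t - k) : ℂ) / ((n + 1).factorial : ℂ))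
      ((bernoulliFun n (t - k) : ℂ) / (n.factorial : ℂ)) t := by
    intro t
    have h := (((hasDerivAt_bernoulliFun (n + 1) (t - k)).comp t
      ((hasDerivAt_id t).sub_const (k : ℝ))).ofReal_comp).div_const ((n + 1).factorial : ℂ)
    refine h.congr_deriv ?_
    rw [hfac, Nat.add_sub_cancel]
    push_cast
    field_simp
  have hmem : ∀ t ∈ Set.uIcc (k : ℝ) (k + 1), 0 ≤ t := by
    intro t ht
    rw [Set.uIcc_of_le (by linarith)] at ht
    exact (Nat.cast_nonneg k).trans ht.1
  have key := intervalIntegral.integral_mul_deriv_eq_deriv_mul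
    (fun t _ => hu t) (fun t ht => hg t (hmem t ht))
    (Continuous.intervalIntegrable (by fun_prop) _ _) hg'
  simp only [add_sub_cancel_left, sub_self] at key
  linear_combination key

theorem intervalIntegrable_natCast_of_Ioi {h : ℝ → ℂ} (hh : IntegrableOn h (Set.Ioi 0)) (k : ℕ) :
    IntervalIntegrable h volume k (k + 1) := by
  rw [intervalIntegrable_iff_integrableOn_Ioc_of_le (by simp)]
  exact hh.mono_set fun x hx => (Nat.cast_nonneg k).trans_lt hx.1

theorem tendsto_sum_intervalIntegral {h : ℝ → ℂ} (hh : IntegrableOn h (Set.Ioi 0)) :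
    Tendsto (fun N : ℕ => ∑ k ∈ Finset.range N, ∫ t in (k : ℝ)..(k : ℝ) + 1, h t) atTop
      (𝓝 (∫ t in Set.Ioi (0 : ℝ), h t)) := by
  have h1 := intervalIntegral_tendsto_integral_Ioi 0 hh tendsto_natCast_atTop_atTop
  refine h1.congr fun N => ?_
  have := intervalIntegral.sum_integral_adjacent_intervals (f := h) (μ := volume)
    (a := fun k : ℕ => (k : ℝ)) (n := N) fun k _ => by
      simpa using intervalIntegrable_natCast_of_Ioi hh k
  simpa using this.symm

/-- Infinite-range integration by parts against periodic Bernoulli functions. -/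
theorem integral_perBernoulli_mul_Ioi {n : ℕ} (hn : 1 ≤ n) {g g' : ℝ → ℂ}
    (hg : ∀ t, 0 ≤ t → HasDerivAt g (g' t) t)
    (hInt : IntegrableOn g (Set.Ioi 0)) (hInt' : IntegrableOn g' (Set.Ioi 0))
    (hlim : Tendsto g atTop (𝓝 0)) :
    ∫ t in Set.Ioi (0 : ℝ), ((perBernoulli n t : ℂ) / (n.factorial : ℂ)) * g t =
      -((bernoulli (n + 1) : ℂ) / ((n + 1).factorial : ℂ)) * g 0 -
        ∫ t in Set.Ioi (0 : ℝ),
          ((perBernoulli (n + 1) t : ℂ) / ((n + 1).factorial : ℂ)) * g' t := by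
  have h1 := tendsto_sum_intervalIntegral (integrableOn_perBernoulli_mul hInt n)
  have h2 := tendsto_sum_intervalIntegral (integrableOn_perBernoulli_mul hInt' (n + 1))
  have h3 : Tendsto (fun N : ℕ => ((bernoulli (n + 1) : ℂ) / ((n + 1).factorial : ℂ)) *
      (g (N : ℝ) - g 0)) atTop
      (𝓝 (((bernoulli (n + 1) : ℂ) / ((n + 1).factorial : ℂ)) * (0 - g 0))) :=
    ((hlim.comp tendsto_natCast_atTop_atTop).sub_const _).const_mul _
  refine tendsto_nhds_unique h1 ?_
  convert (h3.sub h2) using 2 with N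
  · have htel := Finset.sum_range_sub (fun k : ℕ => g (k : ℝ)) N
    rw [Nat.cast_zero] at htel
    rw [← htel, Finset.mul_sum, ← Finset.sum_sub_distrib]
    refine Finset.sum_congr rfl fun k _ => ?_
    rw [integral_perBernoulli_mul_unit n k hg (intervalIntegrable_natCast_of_Ioi hInt' k),
      bernoulliFun_endpoints_eq_of_ne_one (by omega), bernoulliFun_eval_zero]
    push_cast
    ring
  · ring

theorem tsum_eq_integral_add_integral_perBernoulli_one {g g' : ℝ → ℂ}
    (hg : ∀ t, 0 ≤ t → HasDerivAt g (g' t) t)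
    (hInt : IntegrableOn g (Set.Ioi 0)) (hInt' : IntegrableOn g' (Set.Ioi 0))
    (hlim : Tendsto g atTop (𝓝 0)) (hsum : Summable fun k : ℕ => g k) :
    ∑' k : ℕ, g k = (∫ t in Set.Ioi (0 : ℝ), g t) + 1 / 2 * g 0 +
        ∫ t in Set.Ioi (0 : ℝ), ((perBernoulli 1 t : ℂ) / (Nat.factorial 1 : ℂ)) * g' t := by
  have h1 := tendsto_sum_intervalIntegral hInt
  have h2 := tendsto_sum_intervalIntegral (integrableOn_perBernoulli_mul hInt' 1)
  have h3 : Tendsto (fun N : ℕ => (1 / 2 : ℂ) * (g (N : ℝ) - g 0)) atTop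
      (𝓝 ((1 / 2 : ℂ) * (0 - g 0))) :=
    ((hlim.comp tendsto_natCast_atTop_atTop).sub_const _).const_mul _
  refine tendsto_nhds_unique hsum.hasSum.tendsto_sum_nat ?_
  convert ((h1.sub h3).add h2) using 2 with N
  · have htel := Finset.sum_range_sub (fun k : ℕ => g (k : ℝ)) N
    rw [Nat.cast_zero] at htel
    rw [← htel, Finset.mul_sum, ← Finset.sum_sub_distrib, ← Finset.sum_add_distrib]
    refine Finset.sum_congr rfl fun k _ => ?_
    have h := integral_perBernoulli_mul_unit 0 k hg (intervalIntegrable_natCast_of_Ioi hInt' k)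
    simp only [perBernoulli_eq_bernoulliFun, bernoulliFun_zero, zero_add, bernoulliFun_one,
      Nat.factorial_zero, Nat.factorial_one, Nat.cast_one, div_one, ofReal_one, one_mul] at h
    simp only [perBernoulli_eq_bernoulliFun, bernoulliFun_one, Nat.factorial_one,
      Nat.cast_one, div_one]
    rw [h]
    push_cast
    ring
  · ring

/-- The Euler–Maclaurin formula on `[0, ∞)` for a function with a tower of integrable derivatives
vanishing at infinity. -/
theorem tsum_eq_eulerMaclaurin {f : ℕ → ℝ → ℂ}
    (hf : ∀ n t, 0 ≤ t → HasDerivAt (f n) (f (n + 1) t) t)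
    (hInt : ∀ n, IntegrableOn (f n) (Set.Ioi 0)) (hlim : ∀ n, Tendsto (f n) atTop (𝓝 0))
    (hsum : Summable fun k : ℕ => f 0 k) {m : ℕ} (hm : 1 ≤ m) :
    ∑' k : ℕ, f 0 k = (∫ t in Set.Ioi (0 : ℝ), f 0 t) + 1 / 2 * f 0 0 -
        ∑ j ∈ Finset.range m, ((bernoulli (2 * (j + 1)) : ℂ) / ((2 * (j + 1)).factorial : ℂ)) *
          f (2 * (j + 1) - 1) 0 -
        ∫ t in Set.Ioi (0 : ℝ),
          ((perBernoulli (2 * m) t : ℂ) / ((2 * m).factorial : ℂ)) * f (2 * m) t := by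
  have step : ∀ n, 1 ≤ n → _ := fun n hn =>
    integral_perBernoulli_mul_Ioi hn (hf n) (hInt n) (hInt (n + 1)) (hlim n)
  induction m, hm using Nat.le_induction with
  | base =>
    rw [tsum_eq_integral_add_integral_perBernoulli_one (hf 0) (hInt 0) (hInt 1) (hlim 0) hsum,
      step 1 le_rfl]
    simp
    ring
  | succ m hm ih =>
    rw [ih, Finset.sum_range_succ, step (2 * m) (by omega), step (2 * m + 1) (by omega),
      bernoulli_eq_zero_of_odd (n := 2 * m + 1) (by simp) (by omega)]
    simp only [show 2 * (m + 1) = 2 * m + 1 + 1 by ring, Nat.add_sub_cancel]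
    push_cast
    ring

theorem hasDerivAt_aeval_pderiv (p : MvPolynomial (Fin 2) ℤ) (s u : ℂ) :
    HasDerivAt (fun u : ℂ => aeval ![u, s] p) (aeval ![u, s] (pderiv 0 p)) u := by
  induction p using MvPolynomial.induction_on with
  | C a => simpa using hasDerivAt_const u (a : ℂ)
  | add p q hp hq => simpa using! hp.add hq
  | mul_X p i hp =>
    fin_cases i
    · have := hp.mul (hasDerivAt_id u)
      simp only [Fin.zero_eta, map_mul, aeval_X, Derivation.leibniz, pderiv_X_self, smul_eq_mul,
        map_add, mul_one, Matrix.cons_val_zero]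
      exact this.congr_deriv (by simp; ring)
    · have := hp.mul_const s
      simp only [Fin.mk_one, map_mul, aeval_X, Derivation.leibniz, smul_eq_mul, map_add,
        Matrix.cons_val_one, Matrix.cons_val_fin_one]
      rw [pderiv_X_of_ne (by simp)]
      exact this.congr_deriv (by simp; ring)

/-- `qKernel ℓ s n` evaluated at `u = exp (ℓ (t + z))` is, up to the factor `exp (s ℓ t)`, the
`n`-th derivative of `exp (s ℓ t) * (1 - exp (ℓ (t + z))) ^ (-s)` in `t`. -/
noncomputable def qKernel (ℓ s : ℂ) : ℕ → ℂ → ℂ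
  | 0, u => (1 - u) ^ (-s)
  | n + 1, u => s * (1 - u) ^ (-s) * (-1) ^ (n + 1) * (ℓ / (u - 1)) ^ (n + 1) *
      aeval ![u, s] (Puq (n + 1))

theorem exists_hasDerivAt_qKernel (ℓ s : ℂ) (n : ℕ) {u : ℂ} (hu : 1 - u ∈ slitPlane) :
    ∃ d, HasDerivAt (qKernel ℓ s n) d u ∧
      s * ℓ * qKernel ℓ s n u + ℓ * u * d = qKernel ℓ s (n + 1) u := by
  have h0 : 1 - u ≠ 0 := slitPlane_ne_zero hu
  have h1 : u - 1 ≠ 0 := by rw [← neg_sub]; exact neg_ne_zero.mpr h0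
  have hpow : HasDerivAt (fun u : ℂ => (1 - u) ^ (-s)) (s * (1 - u) ^ (-s) / (1 - u)) u := by
    refine (((hasDerivAt_id u).const_sub 1).cpow_const hu).congr_deriv ?_
    simp only [id]
    rw [cpow_sub _ _ h0, cpow_one]
    ring
  cases n with
  | zero =>
    refine ⟨_, hpow, ?_⟩
    simp only [qKernel, Puq, map_one, zero_add, pow_one]
    field_simp
    rw [show u - 1 = -(1 - u) by ring]
    field_simp
    ring
  | succ n =>
    have hq : HasDerivAt (fun u : ℂ => (ℓ / (u - 1)) ^ (n + 1))
        (-((n + 1) * (ℓ / (u - 1)) ^ (n + 1) / (u - 1))) u := by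
      have h := (hasDerivAt_const u ℓ).fun_div ((hasDerivAt_id u).sub_const 1) h1
      refine (h.fun_pow (n + 1)).congr_deriv ?_
      simp only [id, Nat.add_sub_cancel]
      push_cast
      rw [pow_succ (ℓ / (u - 1)) n]
      generalize (ℓ / (u - 1)) ^ n = R
      field_simp
      ring
    refine ⟨_, (((hpow.const_mul s).mul_const ((-1) ^ (n + 1))).mul hq).mul
      (hasDerivAt_aeval_pderiv (Puq (n + 1)) s u), ?_⟩
    simp only [qKernel, Puq, map_add, map_mul, map_sub, map_pow, aeval_X, map_natCast,
      Matrix.cons_val_zero, Matrix.cons_val_one, Matrix.cons_val_fin_one, Pi.mul_apply]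
    generalize aeval ![u, s] (Puq (n + 1)) = P
    generalize aeval ![u, s] (pderiv 0 (Puq (n + 1))) = Q
    generalize (1 - u) ^ (-s) = W
    rw [show 1 - u = -(u - 1) by ring, pow_succ (ℓ / (u - 1)) (n + 1)]
    generalize (ℓ / (u - 1)) ^ (n + 1) = R
    push_cast
    field_simp
    ring

theorem one_sub_mem_slitPlane {u : ℂ} (hu : ‖u‖ < 1) : 1 - u ∈ slitPlane := by
  rw [sub_eq_add_neg]
  exact mem_slitPlane_of_norm_lt_one (by simpa using hu)

/-- The tower of derivatives of `t ↦ exp (s ℓ t) * (1 - exp (ℓ (t + z))) ^ (-s)`. -/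
noncomputable def qTower (ℓ : ℝ) (s z : ℂ) (n : ℕ) (t : ℝ) : ℂ :=
  exp (s * ℓ * t) * qKernel ℓ s n (exp (ℓ * (t + z)))

section Tower

variable {ℓ : ℝ} {s z : ℂ}

theorem norm_exp_mul_add_le (hℓ : ℓ < 0) {t : ℝ} (ht : 0 ≤ t) :
    ‖exp (ℓ * (t + z))‖ ≤ Real.exp (ℓ * z.re) := by
  rw [norm_exp]
  have : (ℓ * ((t : ℂ) + z)).re = ℓ * t + ℓ * z.re := by simp; ring
  rw [this]
  exact Real.exp_le_exp.mpr (by nlinarith)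

theorem norm_exp_mul_add_lt_one (hℓ : ℓ < 0) (hz : 0 < z.re) {t : ℝ} (ht : 0 ≤ t) :
    ‖exp (ℓ * (t + z))‖ < 1 :=
  (norm_exp_mul_add_le hℓ ht).trans_lt (Real.exp_lt_one_iff.mpr (mul_neg_of_neg_of_pos hℓ hz))

theorem hasDerivAt_qTower (hℓ : ℓ < 0) (hz : 0 < z.re) (n : ℕ) {t : ℝ} (ht : 0 ≤ t) :
    HasDerivAt (qTower ℓ s z n) (qTower ℓ s z (n + 1) t) t := by
  obtain ⟨d, hd, hd'⟩ := exists_hasDerivAt_qKernel ℓ s n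
    (one_sub_mem_slitPlane (norm_exp_mul_add_lt_one hℓ hz ht))
  have h1 : HasDerivAt (fun t : ℝ => exp (s * ℓ * t)) (exp (s * ℓ * t) * (s * ℓ)) t := by
    have := ((hasDerivAt_id (t : ℂ)).const_mul (s * ℓ)).cexp.comp_ofReal
    simpa using this
  have h2 : HasDerivAt (fun t : ℝ => exp (ℓ * ((t : ℂ) + z)))
      (exp (ℓ * ((t : ℂ) + z)) * ℓ) t := by
    have := (((hasDerivAt_id (t : ℂ)).add_const z).const_mul (ℓ : ℂ)).cexp.comp_ofReal
    simpa using this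
  refine (h1.mul (hd.comp t h2)).congr_deriv ?_
  simp only [Function.comp, qTower, ← hd']
  ring

theorem exists_norm_qTower_le (hℓ : ℓ < 0) (hz : 0 < z.re) (n : ℕ) :
    ∃ C, ∀ t : ℝ, 0 ≤ t → ‖qTower ℓ s z n t‖ ≤ C * Real.exp (s.re * ℓ * t) := by
  obtain ⟨C, hC⟩ := (isCompact_closedBall (0 : ℂ)
    (Real.exp (ℓ * z.re))).exists_bound_of_continuousOn (f := qKernel ℓ s n) fun u hu => by
      have hu1 : ‖u‖ < 1 := (mem_closedBall_zero_iff.mp hu).trans_lt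
        (Real.exp_lt_one_iff.mpr (mul_neg_of_neg_of_pos hℓ hz))
      obtain ⟨d, hd, -⟩ := exists_hasDerivAt_qKernel ℓ s n (one_sub_mem_slitPlane hu1)
      exact hd.continuousAt.continuousWithinAt
  refine ⟨C, fun t ht => ?_⟩
  rw [qTower, norm_mul, mul_comm, norm_exp]
  have : (s * ℓ * t).re = s.re * ℓ * t := by simp
  rw [this]
  exact mul_le_mul_of_nonneg_right
    (hC _ (mem_closedBall_zero_iff.mpr (norm_exp_mul_add_le hℓ ht))) (Real.exp_pos _).le

theorem integrableOn_qTower (hℓ : ℓ < 0) (hz : 0 < z.re) (hs : 0 < s.re) (n : ℕ) :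
    IntegrableOn (qTower ℓ s z n) (Set.Ioi 0) := by
  obtain ⟨C, hC⟩ := exists_norm_qTower_le (s := s) hℓ hz n
  have hexp : IntegrableOn (fun t : ℝ => Real.exp (s.re * ℓ * t)) (Set.Ioi 0) :=
    integrableOn_exp_mul_Ioi (mul_neg_of_pos_of_neg hs hℓ) 0
  refine Integrable.mono' (hexp.const_mul C) ?_ ?_
  · exact ContinuousOn.aestronglyMeasurable (fun t ht =>
      (hasDerivAt_qTower hℓ hz n (le_of_lt ht)).continuousAt.continuousWithinAt) measurableSet_Ioi
  · exact (ae_restrict_mem measurableSet_Ioi).mono fun t ht => hC t (le_of_lt ht)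

theorem tendsto_qTower (hℓ : ℓ < 0) (hz : 0 < z.re) (hs : 0 < s.re) (n : ℕ) :
    Tendsto (qTower ℓ s z n) atTop (𝓝 0) := by
  obtain ⟨C, hC⟩ := exists_norm_qTower_le (s := s) hℓ hz n
  refine squeeze_zero_norm' ((eventually_ge_atTop 0).mono hC) ?_
  have : Tendsto (fun t : ℝ => s.re * ℓ * t) atTop atBot :=
    tendsto_id.const_mul_atTop_of_neg (mul_neg_of_pos_of_neg hs hℓ)
  simpa using (Real.tendsto_exp_atBot.comp this).const_mul C

theorem summable_qTower (hℓ : ℓ < 0) (hz : 0 < z.re) (hs : 0 < s.re) (n : ℕ) :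
    Summable fun k : ℕ => qTower ℓ s z n k := by
  obtain ⟨C, hC⟩ := exists_norm_qTower_le (s := s) hℓ hz n
  have hgeo : Summable fun k : ℕ => C * Real.exp (s.re * ℓ) ^ k :=
    (summable_geometric_of_lt_one (Real.exp_pos _).le
      (Real.exp_lt_one_iff.mpr (mul_neg_of_pos_of_neg hs hℓ))).mul_left C
  refine Summable.of_norm_bounded hgeo fun k => ?_
  rw [← Real.exp_nat_mul, mul_comm (k : ℝ)]
  exact hC k (Nat.cast_nonneg k)

theorem hasSum_choose_mul_pow {u : ℂ} (hu : ‖u‖ < 1) (s : ℂ) :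
    HasSum (fun n : ℕ => Ring.choose (s + n - 1) n * u ^ n) ((1 - u) ^ (-s)) := by
  have h := (one_div_one_sub_cpow_hasFPowerSeriesOnBall_zero s).hasSum (y := u) (by
    rw [← ENNReal.ofReal_one, Metric.eball_ofReal]; simpa using hu)
  simpa [FormalMultilinearSeries.ofScalars, cpow_neg] using h

theorem gaussHyp_coeff_eq (hs : 0 < s.re) (n : ℕ) :
    Polynomial.eval s (ascPochhammer ℂ n) * Polynomial.eval s (ascPochhammer ℂ n) /
      (Polynomial.eval (s + 1) (ascPochhammer ℂ n) * (n.factorial : ℂ)) =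
    Ring.choose (s + n - 1) n * (s / (s + n)) := by
  have hne : ∀ k : ℕ, s + k ≠ 0 := fun k h => by
    have := congrArg re h
    simp at this
    linarith [(Nat.cast_nonneg k : (0 : ℝ) ≤ k)]
  have hch : (n.factorial : ℂ) * Ring.choose (s + n - 1) n =
      Polynomial.eval s (ascPochhammer ℂ n) := by
    rw [← Ring.multichoose_eq, ← nsmul_eq_mul, Ring.factorial_nsmul_multichoose_eq_ascPochhammer,
      Polynomial.ascPochhammer_smeval_eq_eval]
  have hrec : Polynomial.eval s (ascPochhammer ℂ n) * (s + n) =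
      s * Polynomial.eval (s + 1) (ascPochhammer ℂ n) := by
    rw [← ascPochhammer_succ_eval, ascPochhammer_succ_left]
    simp
  have hfac : (n.factorial : ℂ) ≠ 0 := Nat.cast_ne_zero.mpr n.factorial_ne_zero
  have hpos : Polynomial.eval (s + 1) (ascPochhammer ℂ n) ≠ 0 := by
    rw [Ne, ascPochhammer_eval_eq_zero_iff]
    rintro ⟨k, -, hk⟩
    exact hne (k + 1) (by push_cast; linear_combination hk)
  rw [← mul_div_assoc, div_eq_div_iff (mul_ne_zero hpos hfac) (hne n)]
  linear_combination Polynomial.eval s (ascPochhammer ℂ n) * hrec -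
    s * Polynomial.eval (s + 1) (ascPochhammer ℂ n) * hch

theorem integral_qTower_zero (hℓ : ℓ < 0) (hz : 0 < z.re) (hs : 0 < s.re) :
    ∫ t in Set.Ioi (0 : ℝ), qTower ℓ s z 0 t =
      -(1 / (s * ℓ)) * gaussHyp s s (s + 1) (exp (ℓ * z)) := by
  set w := exp (ℓ * z) with hw
  have hw1 : ‖w‖ < 1 := by simpa using norm_exp_mul_add_lt_one hℓ hz le_rfl
  have hre : ∀ n : ℕ, ((s + n) * ℓ).re = (s.re + n) * ℓ := fun n => by simp
  have hneg : ∀ n : ℕ, ((s + n) * ℓ).re < 0 := fun n => by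
    rw [hre]; exact mul_neg_of_pos_of_neg (by positivity) hℓ
  set F : ℕ → ℝ → ℂ := fun n t =>
    (Ring.choose (s + n - 1) n * w ^ n) * exp ((s + n) * ℓ * t) with hF
  have hnormexp : ∀ (n : ℕ) (t : ℝ), ‖exp ((s + n) * ℓ * t)‖ = Real.exp ((s.re + n) * ℓ * t) :=
    fun n t => by rw [norm_exp, re_mul_ofReal, hre]
  have hpt : ∀ t ∈ Set.Ioi (0 : ℝ), ∑' n, F n t = qTower ℓ s z 0 t := fun t ht => by
    have h := (hasSum_choose_mul_pow (norm_exp_mul_add_lt_one hℓ hz (le_of_lt ht)) s).mul_left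
      (exp (s * ℓ * t))
    rw [qTower, qKernel, ← h.tsum_eq]
    refine tsum_congr fun n => ?_
    simp only [hF, hw]
    rw [← exp_nat_mul, ← exp_nat_mul,
      mul_left_comm (exp (s * ℓ * t)), ← exp_add, mul_assoc, ← exp_add]
    congr 2
    ring
  have hsum : HasSum (fun n => ∫ t in Set.Ioi (0 : ℝ), F n t)
      (∫ t in Set.Ioi (0 : ℝ), ∑' n, F n t) := by
    refine hasSum_integral_of_summable_integral_norm
      (fun n => (integrableOn_exp_mul_complex_Ioi (hneg n) 0).const_mul _) ?_
    refine Summable.of_nonneg_of_le (fun n => integral_nonneg fun t => norm_nonneg _) (fun n => ?_)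
      ((hasSum_choose_mul_pow hw1 s).summable.norm.mul_right (-1 / (s.re * ℓ)))
    simp only [hF, norm_mul _ (exp _), hnormexp]
    rw [integral_const_mul, integral_exp_mul_Ioi (by rw [← hre]; exact hneg n)]
    refine mul_le_mul_of_nonneg_left ?_ (norm_nonneg _)
    rw [mul_zero, Real.exp_zero, ← neg_div_neg_eq, ← neg_div_neg_eq (-1 : ℝ), neg_neg]
    refine one_div_le_one_div_of_le (by nlinarith) ?_
    nlinarith [(Nat.cast_nonneg n : (0 : ℝ) ≤ n)]
  rw [← setIntegral_congr_fun measurableSet_Ioi hpt, ← hsum.tsum_eq, gaussHyp, ← tsum_mul_left]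
  refine tsum_congr fun n => ?_
  have hne : s + n ≠ 0 := fun h => by
    have := hneg n
    simp [h] at this
  have hs0 : s ≠ 0 := fun h => by simp [h] at hs
  have hℓ0 : (ℓ : ℂ) ≠ 0 := ofReal_ne_zero.mpr hℓ.ne
  rw [gaussHyp_coeff_eq hs, hF, integral_const_mul, integral_exp_mul_complex_Ioi (hneg n)]
  simp only [ofReal_zero, mul_zero, exp_zero]
  field_simp

end Tower

theorem ofReal_mul_cpow {r : ℝ} (hr : 0 < r) {w : ℂ} (hw : w ≠ 0) (s : ℂ) :
    ((r : ℂ) * w) ^ s = (r : ℂ) ^ s * w ^ s := by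
  have hr' : (r : ℂ) ≠ 0 := ofReal_ne_zero.mpr hr.ne'
  rw [cpow_def_of_ne_zero (mul_ne_zero hr' hw), cpow_def_of_ne_zero hr', cpow_def_of_ne_zero hw,
    log_ofReal_mul hr hw, ofReal_log hr.le, add_mul, exp_add]

theorem ofReal_div_one_sub_cpow {r : ℝ} (hr : 0 < r) {u : ℂ} (hu : ‖u‖ < 1) (s : ℂ) :
    ((r : ℂ) / (1 - u)) ^ s = (r : ℂ) ^ s * (1 - u) ^ (-s) := by
  have h := one_sub_mem_slitPlane hu
  rw [div_eq_mul_inv, ofReal_mul_cpow hr (inv_ne_zero (slitPlane_ne_zero h)),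
    inv_cpow _ _ (slitPlane_arg_ne_pi h), cpow_neg]

/-- the Euler–MacLaurin expansion of the q-Hurwitz zeta function. -/
theorem qHurwitz_eulerMacLaurin (q : ℝ) (hq0 : 0 < q) (hq1 : q < 1)
    (z : ℂ) (hz : 0 < z.re) (s : ℂ) (hs : 0 < s.re) (m : ℕ) (hm : 1 ≤ m) :
    (∑' k : ℕ, (q : ℂ) ^ (s * (k + 1)) / ((1 - (q : ℂ) ^ ((k : ℂ) + z)) / (1 - (q : ℂ))) ^ s) =
      -(((q : ℂ) - (q : ℂ) ^ 2) ^ s / (s * Real.log q)) * gaussHyp s s (s + 1) ((q : ℂ) ^ z) +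
      (1 / 2 : ℂ) * ((((q : ℂ) - (q : ℂ) ^ 2) / (1 - (q : ℂ) ^ z)) ^ s) +
      s * ((((q : ℂ) - (q : ℂ) ^ 2) / (1 - (q : ℂ) ^ z)) ^ s) *
        (∑ j ∈ Finset.range m,
          ((bernoulli (2 * (j + 1)) : ℂ) / ((2 * (j + 1)).factorial : ℂ)) *
            ((Real.log q : ℂ) / ((q : ℂ) ^ z - 1)) ^ (2 * (j + 1) - 1) *
            aeval ![(q : ℂ) ^ z, s] (Puq (2 * (j + 1) - 1))) -
      s * ∫ t in Set.Ioi (0 : ℝ),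
        ((perBernoulli (2 * m) t : ℂ) / ((2 * m).factorial : ℂ)) *
          ((Real.log q : ℂ) / ((q : ℂ) ^ ((t : ℂ) + z) - 1)) ^ (2 * m) *
          (((1 - (q : ℂ)) / (1 - (q : ℂ) ^ ((t : ℂ) + z))) ^ s) *
          (q : ℂ) ^ (s * ((t : ℂ) + 1)) *
          aeval ![(q : ℂ) ^ ((t : ℂ) + z), s] (Puq (2 * m)) := by
  have hℓ : Real.log q < 0 := Real.log_neg hq0 hq1
  have hq : (q : ℂ) ≠ 0 := ofReal_ne_zero.mpr hq0.ne'
  have hpow : ∀ x : ℂ, (q : ℂ) ^ x = exp (Real.log q * x) := fun x => by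
    rw [cpow_def_of_ne_zero hq, ofReal_log hq0.le]
  have hu : ∀ t : ℝ, 0 ≤ t → ‖exp (Real.log q * (t + z))‖ < 1 := fun t ht =>
    norm_exp_mul_add_lt_one hℓ hz ht
  have hw : ‖exp (Real.log q * z)‖ < 1 := by simpa using hu 0 le_rfl
  have h1q : (1 - (q : ℂ)) = ((1 - q : ℝ) : ℂ) := by push_cast; ring
  have hqq : (q : ℂ) - (q : ℂ) ^ 2 = ((q * (1 - q) : ℝ) : ℂ) := by push_cast; ring
  have h1q0 : 0 < 1 - q := by linarith
  have hc : (((q * (1 - q) : ℝ) : ℂ)) ^ s = exp (Real.log q * s) * ((1 - q : ℝ) : ℂ) ^ s := by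
    rw [ofReal_mul, ofReal_mul_cpow hq0 (ofReal_ne_zero.mpr h1q0.ne'), hpow]
  simp only [hpow, hqq, ofReal_div_one_sub_cpow (mul_pos hq0 h1q0) hw]
  simp only [h1q]
  set c : ℂ := ((q * (1 - q) : ℝ) : ℂ) ^ s with hcdef
  have hsum : (∑' k : ℕ, exp (Real.log q * (s * (k + 1))) /
      ((1 - exp (Real.log q * (k + z))) / ((1 - q : ℝ) : ℂ)) ^ s) =
      c * ∑' k : ℕ, qTower (Real.log q) s z 0 k := by
    rw [← tsum_mul_left]
    refine tsum_congr fun k => ?_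
    have huk := hu k (Nat.cast_nonneg k)
    rw [ofReal_natCast] at huk
    have hinv : (((1 - q : ℝ)⁻¹ : ℝ) : ℂ) ^ s = (((1 - q : ℝ) : ℂ) ^ s)⁻¹ := by
      rw [ofReal_inv, inv_cpow _ _ (by rw [arg_ofReal_of_nonneg h1q0.le]; exact Real.pi_pos.ne)]
    rw [div_eq_inv_mul (1 - exp _), ← ofReal_inv, ofReal_mul_cpow (inv_pos.mpr h1q0)
      (slitPlane_ne_zero (one_sub_mem_slitPlane huk)), hinv, hc, qTower, qKernel, cpow_neg,
      show (Real.log q : ℂ) * (s * (k + 1)) = Real.log q * s + s * Real.log q * k by ring,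
      exp_add, ofReal_natCast]
    field_simp
  have hInt : (∫ t in Set.Ioi (0 : ℝ),
        ((perBernoulli (2 * m) t : ℂ) / ((2 * m).factorial : ℂ)) *
          ((Real.log q : ℂ) / (exp (Real.log q * ((t : ℂ) + z)) - 1)) ^ (2 * m) *
          ((((1 - q : ℝ) : ℂ) / (1 - exp (Real.log q * ((t : ℂ) + z)))) ^ s) *
          exp (Real.log q * (s * ((t : ℂ) + 1))) *
          aeval ![exp (Real.log q * ((t : ℂ) + z)), s] (Puq (2 * m))) * s =
      c * ∫ t in Set.Ioi (0 : ℝ), ((perBernoulli (2 * m) t : ℂ) / ((2 * m).factorial : ℂ)) *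
        qTower (Real.log q) s z (2 * m) t := by
    rw [← integral_mul_const, ← integral_const_mul]
    refine setIntegral_congr_fun measurableSet_Ioi fun t ht => ?_
    obtain ⟨n, hn⟩ : ∃ n, 2 * m = n + 1 := ⟨2 * m - 1, by omega⟩
    have heven : (-1 : ℂ) ^ (n + 1) = 1 := by rw [← hn]; simp
    simp only [hn, qTower, qKernel, heven, hc, ofReal_div_one_sub_cpow h1q0 (hu t (le_of_lt ht))]
    rw [show (Real.log q : ℂ) * (s * (t + 1)) = Real.log q * s + s * Real.log q * t by ring,
      exp_add]
    ring
  have hodd : ∀ j : ℕ, qTower (Real.log q) s z (2 * (j + 1) - 1) 0 =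
      -(s * (1 - exp (Real.log q * z)) ^ (-s) *
        ((Real.log q : ℂ) / (exp (Real.log q * z) - 1)) ^ (2 * (j + 1) - 1) *
        aeval ![exp (Real.log q * z), s] (Puq (2 * (j + 1) - 1))) := fun j => by
    rw [show 2 * (j + 1) - 1 = 2 * j + 1 by omega]
    simp only [qTower, qKernel, ofReal_zero, mul_zero, exp_zero, zero_add, pow_succ (-1 : ℂ),
      pow_mul (-1 : ℂ)]
    ring
  have hzero : qTower (Real.log q) s z 0 0 = (1 - exp (Real.log q * z)) ^ (-s) := by
    simp [qTower, qKernel]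
  rw [hsum, tsum_eq_eulerMaclaurin (fun n t ht => hasDerivAt_qTower hℓ hz n ht)
    (integrableOn_qTower hℓ hz hs) (tendsto_qTower hℓ hz hs) (summable_qTower hℓ hz hs 0) hm,
    integral_qTower_zero hℓ hz hs, hzero, mul_comm s (∫ t in _, _), hInt]
  simp only [hodd]
  rw [mul_sub, mul_sub, mul_add, Finset.mul_sum, Finset.mul_sum,
    sub_eq_add_neg _ (∑ j ∈ _, _), ← Finset.sum_neg_distrib]
  congr 2
  · congr 1
    · ring
    · ring
  · refine Finset.sum_congr rfl fun j _ => ?_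
    ring
end

section
/- For Re(z) > 0 and s not a positive integer, the Hurwitz zeta function satisfies ζ(s,z) = z^{1-s}/(s-1) + z^{-s}/2 + (s z^{-s}/(2πi)) Σ_{l≠0} (1/l) U(1, 1-s; -2πilz), where the sum is over nonzero integers l and U(α,γ;x) = (1/Γ(α)) ∫_0^∞ e^{-xu}(1+u)^{γ-α-1} du is Tricomi's confluent hypergeometric function. -/
open Complex MeasureTheory

section

open Set Filter Topology

/-- Differentiation under the integral sign for a family of holomorphic functions which is
dominated on a disc. -/
theorem hasDerivAt_integral_of_differentiableOn {α : Type*} [MeasurableSpace α] {μ : Measure α}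
    {f : ℂ → α → ℂ} {x₀ : ℂ} {r : ℝ} (hr : 0 < r)
    (hmeas : ∀ x ∈ Metric.ball x₀ r, AEStronglyMeasurable (f x) μ)
    (hdiff : ∀ᵐ a ∂μ, DifferentiableOn ℂ (fun x => f x a) (Metric.ball x₀ r))
    {g : α → ℝ} (hg : Integrable g μ)
    (hb : ∀ᵐ a ∂μ, ∀ x ∈ Metric.ball x₀ r, ‖f x a‖ ≤ g a) :
    HasDerivAt (fun x => ∫ a, f x a ∂μ) (∫ a, deriv (fun x => f x a) x₀ ∂μ) x₀ := by
  have hr2 : 0 < r / 2 := by positivity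
  have hx₀ : x₀ ∈ Metric.ball x₀ r := Metric.mem_ball_self hr
  have hint : Integrable (f x₀) μ := by
    refine hg.mono' (hmeas x₀ hx₀) ?_
    filter_upwards [hb] with a ha using ha x₀ hx₀
  have hder : ∀ᵐ a ∂μ, ∀ x ∈ Metric.ball x₀ (r / 2),
      HasDerivAt (fun x => f x a) (deriv (fun x => f x a) x) x := by
    filter_upwards [hdiff] with a ha x hx
    refine (ha.differentiableAt (Metric.isOpen_ball.mem_nhds ?_)).hasDerivAt
    exact Metric.ball_subset_ball (by linarith) hx
  have hmeas' : AEStronglyMeasurable (fun a => deriv (fun x => f x a) x₀) μ := by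
    have hu : Tendsto (fun n : ℕ => x₀ + ((r / 2 / ((n : ℝ) + 1) : ℝ) : ℂ)) atTop (𝓝[≠] x₀) := by
      rw [tendsto_nhdsWithin_iff]
      constructor
      · have h1 : Tendsto (fun n : ℕ => r / 2 / ((n : ℝ) + 1)) atTop (𝓝 0) := by
          have := (tendsto_one_div_add_atTop_nhds_zero_nat (𝕜 := ℝ)).const_mul (r / 2)
          simpa [div_eq_mul_inv] using this
        have h2 := ((continuous_ofReal.tendsto 0).comp h1).const_add x₀
        simpa [Function.comp_def] using h2
      · refine Eventually.of_forall fun n => ?_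
        have h3 : r / 2 / ((n : ℝ) + 1) ≠ 0 := by positivity
        have : ((r / 2 / ((n : ℝ) + 1) : ℝ) : ℂ) ≠ 0 := ofReal_ne_zero.mpr h3
        simpa using this
    have hball : ∀ n : ℕ, x₀ + ((r / 2 / ((n : ℝ) + 1) : ℝ) : ℂ) ∈ Metric.ball x₀ r := by
      intro n
      rw [Metric.mem_ball, dist_eq, add_sub_cancel_left, norm_real, Real.norm_eq_abs,
        abs_of_pos (by positivity)]
      calc r / 2 / ((n : ℝ) + 1) ≤ r / 2 := div_le_self hr2.le (by linarith [n.cast_nonneg (α := ℝ)])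
        _ < r := by linarith
    refine aestronglyMeasurable_of_tendsto_ae atTop
      (f := fun n : ℕ => fun a => slope (fun x => f x a) x₀
        (x₀ + ((r / 2 / ((n : ℝ) + 1) : ℝ) : ℂ))) (fun n => ?_) ?_
    · simp only [slope, vsub_eq_sub, smul_eq_mul]
      exact ((hmeas _ (hball n)).sub (hmeas _ hx₀)).const_mul _
    · filter_upwards [hder] with a ha
      have := hasDerivAt_iff_tendsto_slope.mp (ha x₀ (Metric.mem_ball_self hr2))
      exact this.comp hu
  refine (hasDerivAt_integral_of_dominated_loc_of_deriv_le
    (F' := fun x a => deriv (fun x => f x a) x) (bound := fun a => g a / (r / 2))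
    (Metric.ball_mem_nhds x₀ hr2) ?_ hint hmeas' ?_ (hg.div_const _) hder).2
  · filter_upwards [Metric.ball_mem_nhds x₀ hr] with x hx using hmeas x hx
  · filter_upwards [hdiff, hb] with a hd hba x hx
    have hx' : dist x x₀ < r / 2 := hx
    have hcl : ∀ w, dist w x ≤ r / 2 → w ∈ Metric.ball x₀ r := fun w hw =>
      Metric.mem_ball.mpr ((dist_triangle w x x₀).trans_lt (by linarith))
    refine norm_deriv_le_of_forall_mem_sphere_norm_le hr2 ?_ fun w hw => hba w (hcl w ?_)
    · apply DifferentiableOn.diffContOnCl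
      rw [closure_ball _ hr2.ne']
      exact hd.mono fun w hw => hcl w hw
    · exact (Metric.mem_sphere.mp hw).le

theorem norm_cpow_le_rpow_mul_exp (a p : ℂ) :
    ‖a ^ p‖ ≤ ‖a‖ ^ p.re * Real.exp (Real.pi * |p.im|) := by
  refine (norm_cpow_le a p).trans ?_
  rw [div_eq_mul_inv, ← Real.exp_neg]
  gcongr
  calc -(arg a * p.im) ≤ |arg a * p.im| := neg_le_abs _
    _ = |arg a| * |p.im| := abs_mul _ _
    _ ≤ Real.pi * |p.im| := by gcongr; exact abs_arg_le_pi a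

/-- A bound for the integrand `exp (-w) * a ^ p` depending on `a` and `p` only through
the constants `K`, `N` and `T`. -/
theorem norm_exp_neg_mul_cpow_le {K T w : ℝ} {N : ℕ} {a p : ℂ} (hK : 1 ≤ K) (hw : 0 ≤ w)
    (ha : K⁻¹ ≤ ‖a‖) (ha' : ‖a‖ ≤ K * (1 + w)) (hN : |p.re| ≤ N) (hT : |p.im| ≤ T) :
    ‖exp (-w) * a ^ p‖ ≤
      ((2 * K) ^ N * N.factorial * Real.exp (1 / 2) * Real.exp (Real.pi * T)) *
        Real.exp (-(1 / 2) * w) := by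
  have hK0 : 0 < K := by linarith
  have ha0 : 0 < ‖a‖ := lt_of_lt_of_le (by positivity) ha
  have hB : 1 ≤ K * (1 + w) := by nlinarith
  have h1 : ‖a‖ ^ p.re ≤ (K * (1 + w)) ^ N := by
    rw [← Real.rpow_natCast]
    rcases le_total 0 p.re with h | h
    · calc ‖a‖ ^ p.re ≤ (K * (1 + w)) ^ p.re := Real.rpow_le_rpow ha0.le ha' h
        _ ≤ _ := Real.rpow_le_rpow_of_exponent_le hB (by rwa [abs_of_nonneg h] at hN)
    · have h2 : ‖a‖⁻¹ ≤ K * (1 + w) := by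
        calc ‖a‖⁻¹ ≤ K := inv_le_of_inv_le₀ hK0 ha
          _ ≤ _ := by nlinarith
      calc ‖a‖ ^ p.re = ‖a‖⁻¹ ^ (-p.re) := by
            rw [Real.inv_rpow ha0.le, Real.rpow_neg ha0.le, inv_inv]
        _ ≤ (K * (1 + w)) ^ (-p.re) := Real.rpow_le_rpow (by positivity) h2 (by linarith)
        _ ≤ _ := Real.rpow_le_rpow_of_exponent_le hB (by rwa [abs_of_nonpos h] at hN)
  have h2 : (K * (1 + w)) ^ N ≤ (2 * K) ^ N * (N.factorial * Real.exp ((1 + w) / 2)) := by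
    have := Real.pow_div_factorial_le_exp ((1 + w) / 2) (by positivity) N
    rw [div_le_iff₀ (by positivity)] at this
    calc (K * (1 + w)) ^ N = (2 * K) ^ N * ((1 + w) / 2) ^ N := by rw [← mul_pow]; congr 1; ring
      _ ≤ _ := by rw [mul_comm (N.factorial : ℝ)]; gcongr
  have h3 : ‖a ^ p‖ ≤ ‖a‖ ^ p.re * Real.exp (Real.pi * T) :=
    (norm_cpow_le_rpow_mul_exp a p).trans (by gcongr)
  have h4 : ‖exp (-(w : ℂ))‖ = Real.exp (-w) := by rw [norm_exp]; simp
  rw [norm_mul, h4]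
  calc Real.exp (-w) * ‖a ^ p‖
      ≤ Real.exp (-w) * (((2 * K) ^ N * (N.factorial * Real.exp ((1 + w) / 2))) *
          Real.exp (Real.pi * T)) := by
        gcongr
        exact h3.trans (mul_le_mul_of_nonneg_right (h1.trans h2) (Real.exp_pos _).le)
    _ = _ := by
        have : Real.exp ((1 + w) / 2) * Real.exp (-w) = Real.exp (1 / 2) * Real.exp (-(1 / 2) * w) := by
          rw [← Real.exp_add, ← Real.exp_add]; congr 1; ring
        linear_combination ((2 * K) ^ N * N.factorial * Real.exp (Real.pi * T)) * this

theorem integrable_exp_neg_half_mul : IntegrableOn (fun w : ℝ => Real.exp (-(1 / 2) * w)) (Ioi 0) :=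
  exp_neg_integrableOn_Ioi 0 (by norm_num)

/-- The function `U(1, 1 - s; x)`, written as an integral which converges
on the whole slit plane. -/
noncomputable def tricomiOne (s x : ℂ) : ℂ :=
  x⁻¹ * ∫ w in Ioi (0 : ℝ), exp (-w) * (1 + w / x) ^ (-s - 1)

theorem one_add_div_mem_slitPlane {x : ℂ} (hx : x ∈ slitPlane) {w : ℝ} (hw : 0 ≤ w) :
    1 + w / x ∈ slitPlane := by
  rcases hw.eq_or_lt with rfl | hw
  · simp
  · by_contra h
    rw [mem_slitPlane_iff, not_or, not_lt, not_not] at h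
    apply slitPlane_ne_zero hx
    have hx0 := slitPlane_ne_zero hx
    set c : ℂ := 1 + w / x with hc
    have hcr : c = (c.re : ℂ) := by apply Complex.ext <;> simp [h.2]
    have h1 : x * ((c.re : ℂ) - 1) = w := by
      rw [← hcr, hc]; field_simp; ring
    have h2 : x = ((w / (c.re - 1) : ℝ) : ℂ) := by
      have : (c.re : ℂ) - 1 ≠ 0 := by
        have : c.re - 1 ≠ 0 := by linarith [h.1]
        exact_mod_cast this
      push_cast; rw [eq_div_iff this]; exact h1
    rw [h2] at hx
    have : 0 < w / (c.re - 1) := ofReal_mem_slitPlane.mp hx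
    have h3 : w / (c.re - 1) < 0 := div_neg_of_pos_of_neg hw (by linarith [h.1])
    linarith

theorem aestronglyMeasurable_tricomi_integrand {x : ℂ} (hx : x ∈ slitPlane) (p : ℂ) :
    AEStronglyMeasurable (fun w : ℝ => exp (-w) * (1 + w / x) ^ p)
      (volume.restrict (Ioi 0)) := by
  refine ContinuousOn.aestronglyMeasurable ?_ measurableSet_Ioi
  refine ContinuousOn.mul (by fun_prop) ?_
  refine ContinuousOn.cpow (by fun_prop) continuousOn_const fun w hw => ?_
  exact one_add_div_mem_slitPlane hx (le_of_lt hw)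

theorem norm_tricomi_integrand_le {x s : ℂ} {K T w : ℝ} {N : ℕ} (hx : x ∈ slitPlane)
    (hK : ∀ w : ℝ, 0 ≤ w → ‖x‖ ≤ K * ‖x + w‖) (hK1 : 1 ≤ K) (hKx : 1 ≤ K * ‖x‖) (hw : 0 ≤ w)
    (hN : |s.re + 1| ≤ N) (hT : |s.im| ≤ T) :
    ‖exp (-w) * (1 + w / x) ^ (-s - 1)‖ ≤
      ((2 * K) ^ N * N.factorial * Real.exp (1 / 2) * Real.exp (Real.pi * T)) *
        Real.exp (-(1 / 2) * w) := by
  have hx0 := slitPlane_ne_zero hx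
  have hxn : 0 < ‖x‖ := norm_pos_iff.mpr hx0
  have hK0 : 0 < K := by linarith
  have he : (1 : ℂ) + w / x = (x + w) / x := by field_simp
  apply norm_exp_neg_mul_cpow_le hK1 hw
  · rw [he, norm_div, le_div_iff₀ hxn, inv_mul_le_iff₀ hK0]
    exact hK w hw
  · calc ‖(1 : ℂ) + w / x‖ ≤ 1 + w / ‖x‖ := by
          refine (norm_add_le _ _).trans ?_
          simp [abs_of_nonneg hw]
      _ ≤ K + K * w := by
          gcongr
          rw [div_le_iff₀ hxn]
          nlinarith
      _ = _ := by ring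
  · rw [← abs_neg]; convert hN using 2; simp; ring
  · simpa using hT

theorem norm_tricomiOne_le {x s : ℂ} {K T : ℝ} {N : ℕ} (hx : x ∈ slitPlane)
    (hK : ∀ w : ℝ, 0 ≤ w → ‖x‖ ≤ K * ‖x + w‖) (hK1 : 1 ≤ K) (hKx : 1 ≤ K * ‖x‖)
    (hN : |s.re + 1| ≤ N) (hT : |s.im| ≤ T) :
    ‖tricomiOne s x‖ ≤ ‖x‖⁻¹ *
      ∫ w in Ioi (0 : ℝ),
        ((2 * K) ^ N * N.factorial * Real.exp (1 / 2) * Real.exp (Real.pi * T)) *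
        Real.exp (-(1 / 2) * w) := by
  rw [tricomiOne, norm_mul, norm_inv]
  gcongr
  refine norm_integral_le_of_norm_le (integrable_exp_neg_half_mul.const_mul _) ?_
  filter_upwards [ae_restrict_mem measurableSet_Ioi] with w hw
  exact norm_tricomi_integrand_le hx hK hK1 hKx (le_of_lt hw) hN hT

theorem differentiableOn_tricomiOne (s : ℂ) : DifferentiableOn ℂ (tricomiOne s) slitPlane := by
  intro x₀ hx₀
  obtain ⟨r, hr, hball⟩ := Metric.isOpen_iff.mp isOpen_slitPlane x₀ hx₀
  have hdist : ∀ w : ℝ, 0 ≤ w → r ≤ ‖x₀ + w‖ := by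
    intro w hw
    by_contra! h
    have : (-(w : ℂ)) ∈ slitPlane := hball (by
      rwa [Metric.mem_ball, dist_eq, ← norm_neg, show -(-(w : ℂ) - x₀) = x₀ + w by ring])
    rw [← ofReal_neg, ofReal_mem_slitPlane] at this
    linarith
  have hnear : ∀ x ∈ Metric.ball x₀ (r / 2), ∀ w : ℝ, 0 ≤ w → r / 2 ≤ ‖x + w‖ := by
    intro x hx w hw
    have h1 := hdist w hw
    have h2 : ‖x - x₀‖ < r / 2 := by simpa [dist_eq] using hx
    have h3 : ‖x₀ + w‖ ≤ ‖x + w‖ + ‖x - x₀‖ := by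
      calc ‖x₀ + w‖ = ‖(x + w) - (x - x₀)‖ := by congr 1; ring
        _ ≤ _ := norm_sub_le _ _
    linarith
  have hsub : Metric.ball x₀ (r / 2) ⊆ slitPlane :=
    (Metric.ball_subset_ball (by linarith)).trans hball
  set M : ℝ := ‖x₀‖ + r with hM
  set K : ℝ := 1 + M / (r / 2) + 1 / (r / 2) with hKdef
  have hM0 : 0 < M := by positivity
  have hK1 : 1 ≤ K := by rw [hKdef, add_assoc]; exact le_add_of_nonneg_right (by positivity)
  have hKM : M / (r / 2) ≤ K := by
    have : 0 ≤ 1 / (r / 2) := by positivity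
    linarith
  have hKr : 1 / (r / 2) ≤ K := by
    have : 0 ≤ M / (r / 2) := by positivity
    linarith
  refine DifferentiableAt.differentiableWithinAt ?_
  refine (differentiableAt_inv (slitPlane_ne_zero hx₀)).mul ?_
  refine (hasDerivAt_integral_of_differentiableOn (r := r / 2) (by positivity)
    (g := fun w => ((2 * K) ^ ⌈|s.re + 1|⌉₊ * (⌈|s.re + 1|⌉₊).factorial * Real.exp (1 / 2) *
      Real.exp (Real.pi * |s.im|)) * Real.exp (-(1 / 2) * w))
    (fun x hx => aestronglyMeasurable_tricomi_integrand (hsub hx) _) ?_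
    (integrable_exp_neg_half_mul.const_mul _) ?_).differentiableAt
  · filter_upwards [ae_restrict_mem measurableSet_Ioi] with w hw
    intro x hx
    have hx' := hsub hx
    have hx0 := slitPlane_ne_zero hx'
    refine DifferentiableAt.differentiableWithinAt ?_
    refine DifferentiableAt.const_mul ?_ _
    exact (((differentiableAt_const _).div differentiableAt_id hx0).const_add _).cpow_const
      (one_add_div_mem_slitPlane hx' (le_of_lt hw))
  · filter_upwards [ae_restrict_mem measurableSet_Ioi] with w hw x hx
    have hxM : ‖x‖ ≤ M := by
      have h2 : ‖x - x₀‖ < r / 2 := by simpa [dist_eq] using hx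
      have := norm_le_norm_add_norm_sub' x x₀
      linarith
    refine norm_tricomi_integrand_le (hsub hx) ?_ hK1 ?_ (le_of_lt hw) (Nat.le_ceil _) le_rfl
    · intro w hw
      calc ‖x‖ ≤ M := hxM
        _ = M / (r / 2) * (r / 2) := by field_simp
        _ ≤ K * ‖x + w‖ := by gcongr; exact hnear x hx w hw
    · calc 1 = 1 / (r / 2) * (r / 2) := by field_simp
        _ ≤ K * ‖x‖ := by gcongr; simpa using hnear x hx 0 le_rfl

theorem differentiable_tricomiOne_left {x : ℂ} (hx : x.im ≠ 0) :
    Differentiable ℂ (fun s => tricomiOne s x) := by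
  have hxs : x ∈ slitPlane := Or.inr hx
  have hx0 := slitPlane_ne_zero hxs
  have hxn : 0 < ‖x‖ := norm_pos_iff.mpr hx0
  intro s₀
  refine DifferentiableAt.const_mul ?_ _
  set K : ℝ := 1 + ‖x‖ / |x.im| + 1 / ‖x‖ with hKdef
  have him : 0 < |x.im| := abs_pos.mpr hx
  have hKM : ‖x‖ / |x.im| ≤ K := by
    have : 0 ≤ 1 / ‖x‖ := by positivity
    linarith
  have hKr : 1 / ‖x‖ ≤ K := by
    have : 0 ≤ ‖x‖ / |x.im| := by positivity
    linarith
  have hK1 : 1 ≤ K := by rw [hKdef, add_assoc]; exact le_add_of_nonneg_right (by positivity)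
  refine (hasDerivAt_integral_of_differentiableOn (r := 1) (by positivity)
    (g := fun w => ((2 * K) ^ ⌈|s₀.re| + 2⌉₊ * (⌈|s₀.re| + 2⌉₊).factorial * Real.exp (1 / 2) *
      Real.exp (Real.pi * (|s₀.im| + 1))) * Real.exp (-(1 / 2) * w))
    (fun s _ => aestronglyMeasurable_tricomi_integrand hxs _) ?_
    (integrable_exp_neg_half_mul.const_mul _) ?_).differentiableAt
  · filter_upwards [ae_restrict_mem measurableSet_Ioi] with w hw
    intro s _
    refine DifferentiableAt.differentiableWithinAt ?_
    refine DifferentiableAt.const_mul ?_ _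
    refine DifferentiableAt.const_cpow (by fun_prop) (Or.inl ?_)
    exact slitPlane_ne_zero (one_add_div_mem_slitPlane hxs (le_of_lt hw))
  · filter_upwards [ae_restrict_mem measurableSet_Ioi] with w hw s hs
    have h2 : ‖s - s₀‖ < 1 := by simpa [dist_eq] using hs
    have hre : |s.re - s₀.re| < 1 := (abs_re_le_norm (s - s₀)).trans_lt h2
    have him' : |s.im - s₀.im| < 1 := (abs_im_le_norm (s - s₀)).trans_lt h2
    refine norm_tricomi_integrand_le hxs ?_ hK1 ?_ (le_of_lt hw)
      (le_trans ?_ (Nat.le_ceil _)) ?_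
    · intro w hw
      calc ‖x‖ = ‖x‖ / |x.im| * |x.im| := by field_simp
        _ ≤ K * ‖x + w‖ := by
          gcongr
          simpa using abs_im_le_norm (x + w)
    · calc 1 = 1 / ‖x‖ * ‖x‖ := by field_simp
        _ ≤ K * ‖x‖ := by gcongr
    · rw [abs_lt] at hre
      rw [abs_le]
      constructor <;> cases abs_cases s₀.re <;> linarith
    · rw [abs_lt] at him'
      rw [abs_le]
      constructor <;> cases abs_cases s₀.im <;> linarith

/-- Holomorphic functions on a domain containing `1` which agree on the positive reals agree. -/
theorem eqOn_of_eq_on_pos_real {Ω : Set ℂ} (hΩ : IsOpen Ω) (hc : IsPreconnected Ω)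
    (h1 : (1 : ℂ) ∈ Ω) {f g : ℂ → ℂ} (hf : DifferentiableOn ℂ f Ω) (hg : DifferentiableOn ℂ g Ω)
    (h : ∀ y : ℝ, 0 < y → f y = g y) : EqOn f g Ω := by
  refine (hf.analyticOnNhd hΩ).eqOn_of_preconnected_of_frequently_eq (hg.analyticOnNhd hΩ) hc h1 ?_
  have hu : Tendsto (fun n : ℕ => (1 : ℂ) + ((1 / ((n : ℝ) + 1) : ℝ) : ℂ)) atTop (𝓝[≠] 1) := by
    rw [tendsto_nhdsWithin_iff]
    constructor
    · have h2 := ((continuous_ofReal.tendsto 0).comp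
        (tendsto_one_div_add_atTop_nhds_zero_nat (𝕜 := ℝ))).const_add (1 : ℂ)
      simpa [Function.comp_def] using h2
    · refine Eventually.of_forall fun n => ?_
      have h3 : 1 / ((n : ℝ) + 1) ≠ 0 := by positivity
      have : ((1 / ((n : ℝ) + 1) : ℝ) : ℂ) ≠ 0 := ofReal_ne_zero.mpr h3
      simpa using this
  refine hu.frequently (Eventually.frequently (Eventually.of_forall fun n => ?_))
  have := h (1 + 1 / ((n : ℝ) + 1)) (by positivity)
  simpa using this

theorem norm_laplace_integrand_le {c u : ℝ} {x p : ℂ} (hc : 0 < c) (hx : c ≤ x.re) (hu : 0 ≤ u) :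
    ‖exp (-x * u) * (1 + u) ^ p‖ ≤
      ((2 / c) ^ ⌈|p.re|⌉₊ * (⌈|p.re|⌉₊).factorial * Real.exp (c / 2)) *
        Real.exp (-(c / 2) * u) := by
  set N := ⌈|p.re|⌉₊ with hN
  have h1 : ‖((1 : ℂ) + u) ^ p‖ ≤ (1 + u) ^ N := by
    have : (1 : ℂ) + u = ((1 + u : ℝ) : ℂ) := by push_cast; rfl
    rw [this, norm_cpow_eq_rpow_re_of_pos (by linarith), ← Real.rpow_natCast]
    exact Real.rpow_le_rpow_of_exponent_le (by linarith) ((le_abs_self _).trans (Nat.le_ceil _))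
  have h2 : (1 + u) ^ N ≤ (2 / c) ^ N * (N.factorial * Real.exp (c * (1 + u) / 2)) := by
    have := Real.pow_div_factorial_le_exp (c * (1 + u) / 2) (by positivity) N
    rw [div_le_iff₀ (by positivity)] at this
    calc (1 + u) ^ N = (2 / c) ^ N * (c * (1 + u) / 2) ^ N := by
          rw [← mul_pow]; congr 1; field_simp
      _ ≤ _ := by rw [mul_comm (N.factorial : ℝ)]; gcongr
  have h3 : ‖exp (-x * u)‖ ≤ Real.exp (-c * u) := by
    rw [norm_exp]
    simp only [mul_re, neg_re, ofReal_re, neg_im, ofReal_im, mul_zero, sub_zero]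
    gcongr
  rw [norm_mul]
  calc ‖exp (-x * u)‖ * ‖((1 : ℂ) + u) ^ p‖
      ≤ Real.exp (-c * u) * ((2 / c) ^ N * (N.factorial * Real.exp (c * (1 + u) / 2))) := by
        gcongr
        exact h1.trans h2
    _ = _ := by
        have : Real.exp (c * (1 + u) / 2) * Real.exp (-c * u) =
            Real.exp (c / 2) * Real.exp (-(c / 2) * u) := by
          rw [← Real.exp_add, ← Real.exp_add]; congr 1; ring
        linear_combination ((2 / c) ^ N * N.factorial) * this

theorem one_add_ofReal_mem_slitPlane {u : ℝ} (hu : 0 ≤ u) : (1 : ℂ) + u ∈ slitPlane := by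
  left; simp; linarith

theorem aestronglyMeasurable_laplace_integrand (x p : ℂ) :
    AEStronglyMeasurable (fun u : ℝ => exp (-x * u) * (1 + u) ^ p)
      (volume.restrict (Ioi 0)) := by
  refine ContinuousOn.aestronglyMeasurable ?_ measurableSet_Ioi
  refine ContinuousOn.mul (by fun_prop) ?_
  exact ContinuousOn.cpow (by fun_prop) continuousOn_const fun u hu =>
    one_add_ofReal_mem_slitPlane (le_of_lt hu)

theorem integrableOn_laplace_integrand {x : ℂ} (hx : 0 < x.re) (p : ℂ) :
    IntegrableOn (fun u : ℝ => exp (-x * u) * (1 + u) ^ p) (Ioi 0) := by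
  refine Integrable.mono' ((exp_neg_integrableOn_Ioi 0 (half_pos hx)).const_mul
    ((2 / x.re) ^ ⌈|p.re|⌉₊ * (⌈|p.re|⌉₊).factorial * Real.exp (x.re / 2)))
    (aestronglyMeasurable_laplace_integrand x p) ?_
  filter_upwards [ae_restrict_mem measurableSet_Ioi] with u hu
  exact norm_laplace_integrand_le hx le_rfl (le_of_lt hu)

theorem hasDerivAt_laplace {x : ℂ} (hx : 0 < x.re) (p : ℂ) :
    HasDerivAt (fun x : ℂ => ∫ u in Ioi (0 : ℝ), exp (-x * u) * (1 + u) ^ p)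
      ((∫ u in Ioi (0 : ℝ), exp (-x * u) * (1 + u) ^ p) -
        ∫ u in Ioi (0 : ℝ), exp (-x * u) * (1 + u) ^ (p + 1)) x := by
  have hr : 0 < x.re / 2 := half_pos hx
  have hd : ∀ (u : ℝ) (y : ℂ), HasDerivAt (fun y : ℂ => exp (-y * u) * ((1 : ℂ) + u) ^ p)
      ((exp (-y * u) * (-1 * u)) * ((1 : ℂ) + u) ^ p) y := fun u y =>
    (((hasDerivAt_id y).neg.mul_const (u : ℂ)).cexp).mul_const _
  have key := hasDerivAt_integral_of_differentiableOn (μ := volume.restrict (Ioi (0 : ℝ))) hr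
    (f := fun (y : ℂ) (u : ℝ) => exp (-y * u) * ((1 : ℂ) + u) ^ p) (x₀ := x)
    (fun y _ => aestronglyMeasurable_laplace_integrand y p)
    (Eventually.of_forall fun u y _ => (hd u y).differentiableAt.differentiableWithinAt)
    ((exp_neg_integrableOn_Ioi 0 (half_pos hr)).const_mul
      ((2 / (x.re / 2)) ^ ⌈|p.re|⌉₊ * (⌈|p.re|⌉₊).factorial * Real.exp (x.re / 2 / 2))) (by
        filter_upwards [ae_restrict_mem measurableSet_Ioi] with u hu y hy
        refine norm_laplace_integrand_le hr ?_ (le_of_lt hu)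
        have h2 : ‖y - x‖ < x.re / 2 := by simpa [dist_eq] using hy
        have := (abs_re_le_norm (y - x)).trans_lt h2
        rw [sub_re, abs_lt] at this
        linarith)
  convert key using 1
  rw [← integral_sub (integrableOn_laplace_integrand hx p)
    (integrableOn_laplace_integrand hx (p + 1))]
  refine setIntegral_congr_fun measurableSet_Ioi fun u hu => ?_
  simp only [(hd u x).deriv]
  rw [cpow_add _ _ (slitPlane_ne_zero (one_add_ofReal_mem_slitPlane (le_of_lt hu))), cpow_one]
  ring

/-- Integration by parts for the Laplace transform of a power. -/
theorem laplace_integral_by_parts {x : ℂ} (hx : 0 < x.re) (s : ℂ) :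
    x * (∫ u in Ioi (0 : ℝ), exp (-x * u) * (1 + u) ^ (-s - 1 + 1)) =
      1 - s * ∫ u in Ioi (0 : ℝ), exp (-x * u) * (1 + u) ^ (-s - 1) := by
  have hint := ((integrableOn_laplace_integrand hx (-s - 1 + 1)).const_mul (-x)).add
    ((integrableOn_laplace_integrand hx (-s - 1)).const_mul (-s))
  have hd : ∀ u ∈ Ici (0 : ℝ), HasDerivAt (fun u : ℝ => exp (-x * u) * ((1 : ℂ) + u) ^ (-s))
      (-x * (exp (-x * u) * ((1 : ℂ) + u) ^ (-s - 1 + 1)) +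
        -s * (exp (-x * u) * ((1 : ℂ) + u) ^ (-s - 1))) u := by
    intro u hu
    have h1 := hasDerivAt_id (u : ℂ)
    have h2 := (h1.const_mul (-x)).cexp
    have h3 := (h1.const_add 1).cpow_const (c := -s) (one_add_ofReal_mem_slitPlane hu)
    convert (h2.mul h3).comp_ofReal using 1
    · rfl
    · rw [sub_add_cancel]; simp only [id]; ring
  have hlim : Tendsto (fun u : ℝ => exp (-x * u) * ((1 : ℂ) + u) ^ (-s)) atTop (𝓝 0) := by
    have hc : 0 < x.re / 2 := half_pos hx
    have h0 : Tendsto (fun u : ℝ => Real.exp (-(x.re / 2) * u)) atTop (𝓝 0) := by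
      refine Real.tendsto_exp_atBot.comp ?_
      exact tendsto_id.const_mul_atTop_of_neg (by linarith)
    have h1 := h0.const_mul ((2 / x.re) ^ ⌈|(-s).re|⌉₊ * (⌈|(-s).re|⌉₊).factorial *
      Real.exp (x.re / 2))
    rw [mul_zero] at h1
    refine squeeze_zero_norm' ?_ h1
    filter_upwards [eventually_ge_atTop 0] with u hu
    exact norm_laplace_integrand_le hx le_rfl hu
  have key := integral_Ioi_of_hasDerivAt_of_tendsto' hd hint hlim
  rw [integral_add ((integrableOn_laplace_integrand hx (-s - 1 + 1)).const_mul (-x))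
    ((integrableOn_laplace_integrand hx (-s - 1)).const_mul (-s)),
    integral_const_mul, integral_const_mul] at key
  simp only [ofReal_zero, mul_zero, exp_zero, add_zero, one_cpow] at key
  linear_combination -key

theorem tricomiOne_ofReal (s : ℂ) {y : ℝ} (hy : 0 < y) :
    tricomiOne s y = ∫ u in Ioi (0 : ℝ), exp (-y * u) * (1 + u) ^ (-s - 1) := by
  have := integral_comp_mul_left_Ioi
    (fun w : ℝ => exp (-w) * ((1 : ℂ) + w / y) ^ (-s - 1)) 0 hy
  have hy0 : (y : ℂ) ≠ 0 := ofReal_ne_zero.mpr hy.ne'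
  rw [mul_zero, real_smul, ofReal_inv] at this
  rw [tricomiOne, ← this]
  refine setIntegral_congr_fun measurableSet_Ioi fun u _ => ?_
  simp only [ofReal_mul]
  rw [mul_div_cancel_left₀ _ hy0, neg_mul]

theorem isPreconnected_slitPlane : IsPreconnected slitPlane :=
  starConvex_one_slitPlane.isPathConnected one_mem_slitPlane |>.isConnected.isPreconnected

theorem tricomiOne_eq_laplace (s : ℂ) {x : ℂ} (hx : 0 < x.re) :
    tricomiOne s x = ∫ u in Ioi (0 : ℝ), exp (-x * u) * (1 + u) ^ (-s - 1) := by
  have hΩ : IsOpen {x : ℂ | 0 < x.re} := isOpen_lt continuous_const continuous_re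
  refine eqOn_of_eq_on_pos_real hΩ (convex_halfSpace_re_gt 0).isPreconnected (by simp)
    ((differentiableOn_tricomiOne s).mono fun x hx => Or.inl hx)
    (g := fun x => ∫ u in Ioi (0 : ℝ), exp (-x * u) * (1 + u) ^ (-s - 1))
    (fun x hx => (hasDerivAt_laplace hx _).differentiableAt.differentiableWithinAt)
    (fun y hy => tricomiOne_ofReal s hy) hx

theorem eqOn_tricomiOne {s : ℂ} {f : ℂ → ℂ} (hf : DifferentiableOn ℂ f slitPlane)
    (hint : ∀ x : ℂ, 0 < x.re → f x = ∫ u in Ioi (0 : ℝ), exp (-x * u) * (1 + u) ^ (-s - 1)) :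
    EqOn f (tricomiOne s) slitPlane :=
  eqOn_of_eq_on_pos_real isOpen_slitPlane isPreconnected_slitPlane one_mem_slitPlane hf
    (differentiableOn_tricomiOne s) fun y hy => by
      rw [tricomiOne_ofReal s hy, hint y (by simpa using hy)]

theorem hasDerivAt_tricomiOne (s : ℂ) {x : ℂ} (hx : x ∈ slitPlane) :
    HasDerivAt (tricomiOne s) (((s + x) * tricomiOne s x - 1) / x) x := by
  have hd := differentiableOn_tricomiOne s
  have hd' : HasDerivAt (tricomiOne s) (deriv (tricomiOne s) x) x :=
    (hd.differentiableAt (isOpen_slitPlane.mem_nhds hx)).hasDerivAt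
  have key : EqOn (fun x => x * deriv (tricomiOne s) x)
      (fun x => (s + x) * tricomiOne s x - 1) slitPlane := by
    refine eqOn_of_eq_on_pos_real isOpen_slitPlane isPreconnected_slitPlane one_mem_slitPlane
      (differentiableOn_id.mul (hd.deriv isOpen_slitPlane))
      (((differentiableOn_const s).add differentiableOn_id).mul hd |>.sub_const 1) fun y hy => ?_
    have hre : 0 < (y : ℂ).re := by simpa using hy
    have hev : tricomiOne s =ᶠ[𝓝 (y : ℂ)]
        fun x => ∫ u in Ioi (0 : ℝ), exp (-x * u) * (1 + u) ^ (-s - 1) := by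
      filter_upwards [(isOpen_lt continuous_const continuous_re).mem_nhds hre] with x hx
      exact tricomiOne_eq_laplace s hx
    rw [((hasDerivAt_laplace hre (-s - 1)).congr_of_eventuallyEq hev).deriv,
      tricomiOne_eq_laplace s hre]
    linear_combination -laplace_integral_by_parts hre s
  have hx' : x * deriv (tricomiOne s) x = (s + x) * tricomiOne s x - 1 := key hx
  rwa [← hx', mul_div_cancel_left₀ _ (slitPlane_ne_zero hx)]

theorem hasSum_one_div_sq_mul_exp {t : ℝ} (ht : t ∈ Icc (0 : ℝ) 1) :
    HasSum (fun l : ℤ => 1 / (l : ℂ) ^ 2 * exp (2 * Real.pi * I * l * t))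
      (-(2 * Real.pi * I) ^ 2 / 2 * ((t : ℂ) ^ 2 - t + 6⁻¹)) := by
  have := hasSum_one_div_pow_mul_fourier_mul_bernoulliFun le_rfl ht
  simp only [fourier_coe_apply, bernoulliFun_two] at this
  push_cast at this
  simpa using this

/-- The Fourier series of the sawtooth function, paired with a continuously differentiable
function. -/
theorem hasSum_one_div_mul_integral_exp_mul {g g' : ℝ → ℂ}
    (hg : ∀ t ∈ uIcc (0 : ℝ) 1, HasDerivAt g (g' t) t) (hg' : ContinuousOn g' (uIcc 0 1)) :
    HasSum (fun l : ℤ => 1 / (l : ℂ) * ∫ t in (0 : ℝ)..1, exp (2 * Real.pi * I * l * t) * g t)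
      (-(2 * Real.pi * I) * ∫ t in (0 : ℝ)..1, ((t : ℂ) - 1 / 2) * g t) := by
  have hpi : (2 * Real.pi * I : ℂ) ≠ 0 := two_pi_I_ne_zero
  have hgi : IntervalIntegrable g' volume 0 1 := hg'.intervalIntegrable
  have hsumR : Summable fun l : ℤ => 1 / (l : ℝ) ^ 2 :=
    Real.summable_one_div_int_pow.mpr one_lt_two
  set P : ℝ → ℂ := fun t => -(2 * Real.pi * I) ^ 2 / 2 * ((t : ℂ) ^ 2 - t + 6⁻¹) with hP
  have hA : HasSum (fun l : ℤ => ∫ t in (0 : ℝ)..1,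
      1 / (l : ℂ) ^ 2 * exp (2 * Real.pi * I * l * t) * g' t)
      (∫ t in (0 : ℝ)..1, P t * g' t) := by
    refine intervalIntegral.hasSum_integral_of_dominated_convergence
      (fun l t => 1 / (l : ℝ) ^ 2 * ‖g' t‖) (fun l => ?_) (fun l => ?_) ?_ ?_ ?_
    · refine (ContinuousOn.mul (by fun_prop)
        (hg'.mono uIoc_subset_uIcc)).aestronglyMeasurable measurableSet_uIoc
    · refine Eventually.of_forall fun t _ => ?_
      rw [norm_mul, norm_mul, norm_div, norm_pow, norm_one, norm_intCast, sq_abs,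
        show 2 * Real.pi * I * l * t = ((2 * Real.pi * l * t : ℝ) : ℂ) * I by push_cast; ring,
        norm_exp_ofReal_mul_I, mul_one]
    · exact Eventually.of_forall fun t _ => hsumR.mul_right _
    · simp only [tsum_mul_right]
      exact hgi.norm.const_mul _
    · refine Eventually.of_forall fun t ht => ?_
      have ht' : t ∈ Icc (0 : ℝ) 1 := by
        rw [← uIcc_of_le zero_le_one]; exact uIoc_subset_uIcc ht
      exact (hasSum_one_div_sq_mul_exp ht').mul_right _
  have hB : HasSum (fun l : ℤ => 1 / (l : ℂ) ^ 2 * (g 1 - g 0)) (P 0 * (g 1 - g 0)) := by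
    have := (hasSum_one_div_sq_mul_exp (t := 0) (by simp)).mul_right (g 1 - g 0)
    simpa [hP] using this
  have hC := (hB.sub hA).mul_left (2 * Real.pi * I)⁻¹
  have hparts : ∫ t in (0 : ℝ)..1, P t * g' t = P 1 * g 1 - P 0 * g 0 -
      ∫ t in (0 : ℝ)..1, (-(2 * Real.pi * I) ^ 2 * ((t : ℂ) - 1 / 2)) * g t := by
    refine intervalIntegral.integral_mul_deriv_eq_deriv_mul (fun t _ => ?_) hg
      (Continuous.intervalIntegrable (by fun_prop) _ _) hgi
    have h1 := hasDerivAt_id (t : ℂ)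
    convert! ((((h1.pow 2).sub h1).add_const (6⁻¹ : ℂ)).const_mul
      (-(2 * Real.pi * I) ^ 2 / 2)).comp_ofReal using 1
    simp only [id]; push_cast; ring
  convert! hC using 1
  · funext l
    rcases eq_or_ne l 0 with rfl | hl
    · simp
    have hl' : (l : ℂ) ≠ 0 := Int.cast_ne_zero.mpr hl
    have hpl : ∫ t in (0 : ℝ)..1, exp (2 * Real.pi * I * l * t) * g' t =
        exp (2 * Real.pi * I * l * (1 : ℝ)) * g 1 - exp (2 * Real.pi * I * l * (0 : ℝ)) * g 0 -
        ∫ t in (0 : ℝ)..1,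
          (exp (2 * Real.pi * I * l * t) * (2 * Real.pi * I * l)) * g t := by
      refine intervalIntegral.integral_mul_deriv_eq_deriv_mul (fun t _ => ?_) hg
        (Continuous.intervalIntegrable (by fun_prop) _ _) hgi
      have := (((hasDerivAt_id (t : ℂ)).const_mul (2 * Real.pi * I * l)).cexp).comp_ofReal
      simpa using this
    have he : exp (2 * Real.pi * I * l) = 1 := by
      rw [mul_comm]; exact exp_int_mul_two_pi_mul_I l
    simp only [ofReal_one, mul_one, ofReal_zero, mul_zero, exp_zero, one_mul, he,
      mul_right_comm _ (2 * Real.pi * I * l : ℂ), intervalIntegral.integral_mul_const] at hpl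
    simp only [mul_assoc (1 / (l : ℂ) ^ 2), intervalIntegral.integral_const_mul, hpl]
    field_simp
    ring
  · rw [hparts]
    simp only [mul_assoc (-(2 * Real.pi * I : ℂ) ^ 2), intervalIntegral.integral_const_mul]
    simp only [hP]
    push_cast
    field_simp
    ring

theorem im_neg_two_pi_I_mul (l : ℤ) (z : ℂ) :
    (-2 * Real.pi * I * l * z).im = -(2 * Real.pi * l * z.re) := by
  simp

theorem neg_two_pi_I_mul_im_ne_zero {l : ℤ} (hl : l ≠ 0) {z : ℂ} (hz : 0 < z.re) :
    (-2 * Real.pi * I * l * z).im ≠ 0 := by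
  rw [im_neg_two_pi_I_mul, neg_ne_zero]
  have : (l : ℝ) ≠ 0 := Int.cast_ne_zero.mpr hl
  positivity

theorem tricomiOne_sub_shift (s : ℂ) {z : ℂ} (hz : 0 < z.re) {l : ℤ} (hl : l ≠ 0) :
    z ^ (-s) * tricomiOne s (-2 * Real.pi * I * l * z) -
      (z + 1) ^ (-s) * tricomiOne s (-2 * Real.pi * I * l * (z + 1)) =
    ∫ t in (0 : ℝ)..1, exp (2 * Real.pi * I * l * t) * (t + z) ^ (-s - 1) := by
  have hpos : ∀ t ∈ uIcc (0 : ℝ) 1, 0 < ((t : ℂ) + z).re := by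
    intro t ht
    rw [uIcc_of_le zero_le_one] at ht
    simp only [add_re, ofReal_re]
    linarith [ht.1]
  have hp : (-2 * Real.pi * I * l : ℂ) ≠ 0 := by
    have : (l : ℂ) ≠ 0 := Int.cast_ne_zero.mpr hl
    have := two_pi_I_ne_zero
    simp_all
  have hd : ∀ t ∈ uIcc (0 : ℝ) 1, HasDerivAt (fun t : ℝ => exp (2 * Real.pi * I * l * t) *
      ((t + z) ^ (-s) * tricomiOne s (-2 * Real.pi * I * l * (t + z))))
      (-(exp (2 * Real.pi * I * l * t) * (t + z) ^ (-s - 1))) t := by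
    intro t ht
    have hy := hpos t ht
    have hy0 : (t : ℂ) + z ≠ 0 := slitPlane_ne_zero (Or.inl hy)
    have h1 := hasDerivAt_id (t : ℂ)
    have h2 := (h1.const_mul (2 * Real.pi * I * l)).cexp
    have h3 := (h1.add_const z).cpow_const (c := -s) (Or.inl hy)
    have h4 := (hasDerivAt_tricomiOne s
      (Or.inr (neg_two_pi_I_mul_im_ne_zero hl hy))).comp (t : ℂ)
        ((h1.add_const z).const_mul (-2 * Real.pi * I * l))
    convert (h2.mul (h3.mul h4)).comp_ofReal using 1
    · rfl
    · have h5 : ((t : ℂ) + z) ^ (-s) = (t + z) ^ (-s - 1) * (t + z) := by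
        rw [cpow_sub _ _ hy0, cpow_one]; field_simp
      simp only [id, Function.comp, h5, Pi.mul_apply]
      field_simp
      ring
  have hcont : ContinuousOn
      (fun t : ℝ => -(exp (2 * Real.pi * I * l * t) * ((t : ℂ) + z) ^ (-s - 1))) (uIcc 0 1) := by
    refine (ContinuousOn.mul (by fun_prop) ?_).neg
    exact ContinuousOn.cpow (by fun_prop) continuousOn_const fun t ht => Or.inl (hpos t ht)
  have key := intervalIntegral.integral_eq_sub_of_hasDerivAt hd hcont.intervalIntegrable
  have he : exp (2 * Real.pi * I * l) = 1 := by
    rw [mul_comm]; exact exp_int_mul_two_pi_mul_I l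
  rw [intervalIntegral.integral_neg] at key
  simp only [ofReal_one, mul_one, ofReal_zero, mul_zero, exp_zero, one_mul, he, zero_add,
    add_comm (1 : ℂ) z] at key
  linear_combination key

theorem mul_integral_sawtooth_mul_cpow {s z : ℂ} (hz : 0 < z.re) (hs : s ≠ 1) :
    s * ∫ t in (0 : ℝ)..1, ((t : ℂ) - 1 / 2) * ((t : ℂ) + z) ^ (-s - 1) =
      -(z ^ (-s) / 2) - (z + 1) ^ (-s) / 2 +
        ((z + 1) ^ (1 - s) / (1 - s) - z ^ (1 - s) / (1 - s)) := by
  have hpos : ∀ t ∈ uIcc (0 : ℝ) 1, 0 < ((t : ℂ) + z).re := by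
    intro t ht
    rw [uIcc_of_le zero_le_one] at ht
    simp only [add_re, ofReal_re]
    linarith [ht.1]
  have hs' : 1 - s ≠ 0 := sub_ne_zero.mpr hs.symm
  have hd : ∀ t ∈ uIcc (0 : ℝ) 1, HasDerivAt
      (fun t : ℝ => -(((t : ℂ) - 1 / 2) * (t + z) ^ (-s)) + (t + z) ^ (1 - s) / (1 - s))
      (s * (((t : ℂ) - 1 / 2) * ((t : ℂ) + z) ^ (-s - 1))) t := by
    intro t ht
    have h1 := hasDerivAt_id (t : ℂ)
    have h2 := (h1.add_const z).cpow_const (c := -s) (Or.inl (hpos t ht))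
    have h3 := (h1.add_const z).cpow_const (c := 1 - s) (Or.inl (hpos t ht))
    convert ((((h1.sub_const (1 / 2)).mul h2).neg).add (h3.div_const (1 - s))).comp_ofReal using 1
    · rfl
    · simp only [id, sub_sub_cancel_left, mul_one]
      rw [mul_div_cancel_left₀ _ hs']
      ring
  have hcont : ContinuousOn
      (fun t : ℝ => s * (((t : ℂ) - 1 / 2) * ((t : ℂ) + z) ^ (-s - 1))) (uIcc 0 1) := by
    refine (ContinuousOn.mul (by fun_prop) ?_).const_mul _
    exact ContinuousOn.cpow (by fun_prop) continuousOn_const fun t ht => Or.inl (hpos t ht)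
  have key := intervalIntegral.integral_eq_sub_of_hasDerivAt hd hcont.intervalIntegrable
  rw [intervalIntegral.integral_const_mul] at key
  rw [key]
  simp only [ofReal_one, ofReal_zero, zero_add, add_comm (1 : ℂ) z]
  ring

theorem exists_norm_tricomiOne_le (K T : ℝ) (N : ℕ) (hK : 1 ≤ K) :
    ∃ C : ℝ, ∀ (s z : ℂ) (l : ℤ), 0 < z.re → ‖z‖ ≤ K * z.re → 1 ≤ K * ‖z‖ →
      |s.re + 1| ≤ N → |s.im| ≤ T →
      ‖1 / (l : ℂ) * tricomiOne s (-2 * Real.pi * I * l * z)‖ ≤ C * (1 / (l : ℝ) ^ 2) := by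
  set J : ℝ := ∫ w in Ioi (0 : ℝ),
    ((2 * K) ^ N * N.factorial * Real.exp (1 / 2) * Real.exp (Real.pi * T)) *
      Real.exp (-(1 / 2) * w) with hJ
  have hJ0 : 0 ≤ J := setIntegral_nonneg measurableSet_Ioi fun w _ => by positivity
  refine ⟨K * J, fun s z l hz hKz hKz' hN hT => ?_⟩
  rcases eq_or_ne l 0 with rfl | hl
  · simp
  have hl1 : (1 : ℝ) ≤ |(l : ℝ)| := by exact_mod_cast Int.one_le_abs hl
  have hl0 : 0 < |(l : ℝ)| := by linarith
  have hzn : 0 < ‖z‖ := lt_of_lt_of_le hz (re_le_norm z)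
  have hpi : 1 ≤ 2 * Real.pi := by linarith [Real.pi_gt_three]
  have him := neg_two_pi_I_mul_im_ne_zero hl hz
  set x : ℂ := -2 * Real.pi * I * l * z with hx
  have hxn : ‖x‖ = 2 * Real.pi * |(l : ℝ)| * ‖z‖ := by
    simp [hx, abs_of_pos Real.pi_pos]
  have hlx : |(l : ℝ)| * ‖z‖ ≤ ‖x‖ := by
    rw [hxn]
    calc |(l : ℝ)| * ‖z‖ = 1 * (|(l : ℝ)| * ‖z‖) := (one_mul _).symm
      _ ≤ 2 * Real.pi * (|(l : ℝ)| * ‖z‖) := by gcongr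
      _ = _ := by ring
  have hT1 : ‖tricomiOne s x‖ ≤ ‖x‖⁻¹ * J := by
    refine norm_tricomiOne_le (Or.inr him) (fun w _ => ?_) hK ?_ hN hT
    · have h1 : 2 * Real.pi * |(l : ℝ)| * z.re ≤ ‖x + w‖ := by
        have := abs_im_le_norm (x + w)
        rw [add_im, ofReal_im, add_zero, hx, im_neg_two_pi_I_mul, abs_neg, abs_mul, abs_mul,
          abs_of_pos hz, abs_of_pos Real.two_pi_pos] at this
        exact this
      calc ‖x‖ = 2 * Real.pi * |(l : ℝ)| * ‖z‖ := hxn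
        _ ≤ 2 * Real.pi * |(l : ℝ)| * (K * z.re) := by gcongr
        _ = K * (2 * Real.pi * |(l : ℝ)| * z.re) := by ring
        _ ≤ K * ‖x + w‖ := by gcongr
    · refine hKz'.trans ?_
      gcongr
      refine le_trans ?_ hlx
      exact le_mul_of_one_le_left hzn.le hl1
  have hxinv : ‖x‖⁻¹ ≤ |(l : ℝ)|⁻¹ * K := by
    rw [inv_le_comm₀ (lt_of_lt_of_le (by positivity) hlx) (by positivity), mul_inv, inv_inv]
    refine le_trans ?_ hlx
    gcongr
    rwa [inv_le_iff_one_le_mul₀' (by linarith)]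
  rw [norm_mul, norm_div, norm_one, norm_intCast]
  calc 1 / |(l : ℝ)| * ‖tricomiOne s x‖ ≤ 1 / |(l : ℝ)| * (|(l : ℝ)|⁻¹ * K * J) := by
        gcongr
        exact hT1.trans (by gcongr)
    _ = K * J * (1 / |(l : ℝ)| ^ 2) := by ring
    _ = _ := by rw [sq_abs]

/-- A constant controlling the distance of `z` from the boundary of the right half-plane. -/
theorem exists_norm_le_mul_re {z : ℂ} (hz : 0 < z.re) :
    ∃ K : ℝ, 1 ≤ K ∧ ∀ n : ℕ, ‖z + n‖ ≤ K * (z + n).re ∧ 1 ≤ K * ‖z + n‖ := by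
  have hzn : 0 < ‖z‖ := lt_of_lt_of_le hz (re_le_norm z)
  have h1 : 0 < ‖z‖ / z.re := by positivity
  have h2 : 0 < 1 / z.re := by positivity
  refine ⟨1 + ‖z‖ / z.re + 1 / z.re, by linarith, fun n => ?_⟩
  have hn : (0 : ℝ) ≤ n := n.cast_nonneg
  have h3 : ‖z‖ / z.re * z.re = ‖z‖ := by field_simp
  have h4 : 1 / z.re * z.re = 1 := by field_simp
  have hre : (z + n).re = z.re + n := by simp
  constructor
  · have h5 : ‖z + n‖ ≤ ‖z‖ + n := by simpa using norm_add_le z n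
    rw [hre]
    have h6 : 0 ≤ ‖z‖ / z.re * n := by positivity
    have h7 : 0 ≤ 1 / z.re * n := by positivity
    linarith
  · have h5 := re_le_norm (z + n)
    rw [hre] at h5
    have h6 : 1 / z.re * z.re ≤ 1 / z.re * ‖z + n‖ := by gcongr; linarith
    have h7 : 0 ≤ ‖z‖ / z.re * ‖z + n‖ := by positivity
    have h8 := norm_nonneg (z + n)
    linarith

theorem summable_tricomiOne (s : ℂ) {z : ℂ} (hz : 0 < z.re) :
    Summable fun l : ℤ => 1 / (l : ℂ) * tricomiOne s (-2 * Real.pi * I * l * z) := by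
  obtain ⟨K, hK, h⟩ := exists_norm_le_mul_re hz
  obtain ⟨C, hC⟩ := exists_norm_tricomiOne_le K |s.im| ⌈|s.re + 1|⌉₊ hK
  have h0 := h 0
  rw [Nat.cast_zero, add_zero] at h0
  exact Summable.of_norm_bounded
    ((Real.summable_one_div_int_pow.mpr one_lt_two).mul_left C)
    fun l => hC s z l hz h0.1 h0.2 (Nat.le_ceil _) le_rfl

/-- The right-hand side of the expansion of the Hurwitz zeta function. -/
noncomputable def tricomiExpansion (s z : ℂ) : ℂ :=
  z ^ (1 - s) / (s - 1) + z ^ (-s) / 2 + (s * z ^ (-s) / (2 * Real.pi * I)) *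
    ∑' l : ℤ, 1 / (l : ℂ) * tricomiOne s (-2 * Real.pi * I * l * z)

theorem tricomiExpansion_sub_shift {s z : ℂ} (hz : 0 < z.re) (hs : s ≠ 1) :
    tricomiExpansion s z - tricomiExpansion s (z + 1) = z ^ (-s) := by
  have hz1 : 0 < (z + 1).re := by simp; linarith
  have hpos : ∀ t ∈ uIcc (0 : ℝ) 1, (t : ℂ) + z ∈ slitPlane := by
    intro t ht
    rw [uIcc_of_le zero_le_one] at ht
    left
    simp only [add_re, ofReal_re]
    linarith [ht.1]
  have h1 := ((summable_tricomiOne s hz).hasSum.mul_left (z ^ (-s))).sub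
    ((summable_tricomiOne s hz1).hasSum.mul_left ((z + 1) ^ (-s)))
  have h2 := hasSum_one_div_mul_integral_exp_mul
    (g := fun t : ℝ => ((t : ℂ) + z) ^ (-s - 1))
    (g' := fun t : ℝ => (-s - 1) * ((t : ℂ) + z) ^ (-s - 1 - 1))
    (fun t ht => by
      have := (((hasDerivAt_id (t : ℂ)).add_const z).cpow_const (c := -s - 1)
        (hpos t ht)).comp_ofReal
      simpa using this)
    (continuousOn_const.mul (ContinuousOn.cpow (by fun_prop) continuousOn_const hpos))
  have h3 : ∀ l : ℤ, z ^ (-s) * (1 / (l : ℂ) * tricomiOne s (-2 * Real.pi * I * l * z)) -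
      (z + 1) ^ (-s) * (1 / (l : ℂ) * tricomiOne s (-2 * Real.pi * I * l * (z + 1))) =
      1 / (l : ℂ) *
        ∫ t in (0 : ℝ)..1, exp (2 * Real.pi * I * l * t) * ((t : ℂ) + z) ^ (-s - 1) := by
    intro l
    rcases eq_or_ne l 0 with rfl | hl
    · simp
    · rw [← tricomiOne_sub_shift s hz hl]; ring
  simp only [h3] at h1
  have h4 := h1.unique h2
  have h5 := mul_integral_sawtooth_mul_cpow hz hs
  have hpi : (2 * Real.pi * I : ℂ) ≠ 0 := two_pi_I_ne_zero
  have hs1 : s - 1 ≠ 0 := sub_ne_zero.mpr hs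
  have hs2 : (1 - s) = -(s - 1) := by ring
  simp only [tricomiExpansion]
  set S := ∑' l : ℤ, 1 / (l : ℂ) * tricomiOne s (-2 * Real.pi * I * l * z)
  set S' := ∑' l : ℤ, 1 / (l : ℂ) * tricomiOne s (-2 * Real.pi * I * l * (z + 1))
  have h6 : s * z ^ (-s) / (2 * Real.pi * I) * S - s * (z + 1) ^ (-s) / (2 * Real.pi * I) * S' =
      -(s * ∫ t in (0 : ℝ)..1, ((t : ℂ) - 1 / 2) * ((t : ℂ) + z) ^ (-s - 1)) := by
    calc _ = s / (2 * Real.pi * I) * (z ^ (-s) * S - (z + 1) ^ (-s) * S') := by ring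
      _ = _ := by rw [h4]; field_simp
  have h7 : ∀ a : ℂ, a / (1 - s) = -(a / (s - 1)) := fun a => by rw [hs2, div_neg]
  rw [h5, h7, h7] at h6
  linear_combination h6

theorem tendsto_norm_add_natCast_atTop (z : ℂ) : Tendsto (fun n : ℕ => ‖z + n‖) atTop atTop := by
  refine tendsto_atTop_mono (f := fun n : ℕ => z.re + n) (fun n => ?_)
    (tendsto_atTop_add_const_left _ _ tendsto_natCast_atTop_atTop)
  simpa using re_le_norm (z + n)

theorem tendsto_add_natCast_cpow (z : ℂ) {p : ℂ} (hp : p.re < 0) :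
    Tendsto (fun n : ℕ => (z + n) ^ p) atTop (𝓝 0) := by
  have h1 := ((tendsto_rpow_neg_atTop (neg_pos.mpr hp)).comp
    (tendsto_norm_add_natCast_atTop z)).mul_const (Real.exp (Real.pi * |p.im|))
  rw [zero_mul] at h1
  refine squeeze_zero_norm (fun n => ?_) h1
  simpa using norm_cpow_le_rpow_mul_exp (z + n) p

theorem tendsto_tricomiExpansion {s z : ℂ} (hz : 0 < z.re) (hs : 1 < s.re) :
    Tendsto (fun n : ℕ => tricomiExpansion s (z + n)) atTop (𝓝 0) := by
  obtain ⟨K, hK, h⟩ := exists_norm_le_mul_re hz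
  obtain ⟨C, hC⟩ := exists_norm_tricomiOne_le K |s.im| ⌈|s.re + 1|⌉₊ hK
  have hsum := (Real.summable_one_div_int_pow.mpr one_lt_two).mul_left C
  have hbdd : ∀ n : ℕ, ‖∑' l : ℤ, 1 / (l : ℂ) * tricomiOne s (-2 * Real.pi * I * l * (z + n))‖ ≤
      ∑' l : ℤ, C * (1 / (l : ℝ) ^ 2) := fun n =>
    tsum_of_norm_bounded hsum.hasSum fun l => hC s (z + n) l
      (by simp only [add_re, natCast_re]; positivity) (h n).1 (h n).2 (Nat.le_ceil _) le_rfl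
  have h1 := (tendsto_add_natCast_cpow z (p := 1 - s) (by simpa using hs)).div_const (s - 1)
  have h2 := tendsto_add_natCast_cpow z (p := -s) (by simp; linarith)
  have h3 := (h2.const_mul s).div_const (2 * Real.pi * I)
  have h4 : Tendsto (fun n : ℕ => s * (z + n) ^ (-s) / (2 * Real.pi * I) *
      ∑' l : ℤ, 1 / (l : ℂ) * tricomiOne s (-2 * Real.pi * I * l * (z + n))) atTop (𝓝 0) := by
    have h5 := h3.norm.mul_const (∑' l : ℤ, C * (1 / (l : ℝ) ^ 2))
    simp only [mul_zero, zero_div, norm_zero, zero_mul] at h5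
    refine squeeze_zero_norm (fun n => ?_) h5
    rw [norm_mul]
    gcongr
    exact hbdd n
  simpa [tricomiExpansion] using (h1.add (h2.div_const 2)).add h4

theorem summable_natCast_add_cpow {s z : ℂ} (hz : 0 < z.re) (hs : 1 < s.re) :
    Summable fun k : ℕ => ((k : ℂ) + z) ^ (-s) := by
  refine Summable.of_norm_bounded
    (((Real.summable_one_div_nat_add_rpow z.re s.re).mpr hs).mul_right
      (Real.exp (Real.pi * |s.im|))) fun k => ?_
  have hk : 0 < (k : ℝ) + z.re := by positivity
  refine (norm_cpow_le_rpow_mul_exp _ _).trans ?_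
  rw [neg_re, neg_im, abs_neg, abs_of_pos hk, one_div, ← Real.rpow_neg hk.le]
  refine mul_le_mul_of_nonneg_right ?_ (Real.exp_pos _).le
  refine Real.rpow_le_rpow_of_nonpos hk ?_ (by linarith)
  simpa using re_le_norm ((k : ℂ) + z)

theorem tsum_natCast_add_cpow_eq_tricomiExpansion {s z : ℂ} (hz : 0 < z.re) (hs : 1 < s.re) :
    ∑' k : ℕ, ((k : ℂ) + z) ^ (-s) = tricomiExpansion s z := by
  have hs1 : s ≠ 1 := by rintro rfl; simp at hs
  have h1 := (summable_natCast_add_cpow hz hs).hasSum.tendsto_sum_nat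
  have h2 : ∀ n : ℕ, ∑ k ∈ Finset.range n, ((k : ℂ) + z) ^ (-s) =
      tricomiExpansion s z - tricomiExpansion s (z + n) := by
    intro n
    have := Finset.sum_range_sub' (fun n : ℕ => tricomiExpansion s (z + n)) n
    simp only [Nat.cast_zero, add_zero] at this
    rw [← this]
    refine Finset.sum_congr rfl fun k _ => ?_
    have hk : 0 < (z + k).re := by simp only [add_re, natCast_re]; positivity
    rw [Nat.cast_succ, ← add_assoc, tricomiExpansion_sub_shift hk hs1, add_comm]
  simp only [h2] at h1
  have h3 := (tendsto_tricomiExpansion hz hs).const_sub (tricomiExpansion s z)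
  rw [sub_zero] at h3
  exact tendsto_nhds_unique h1 h3

theorem differentiableOn_tricomiExpansion {z : ℂ} (hz : 0 < z.re) :
    DifferentiableOn ℂ (fun s => tricomiExpansion s z) {s : ℂ | s ≠ 1} := by
  have hz0 : z ≠ 0 := slitPlane_ne_zero (Or.inl hz)
  obtain ⟨K, hK, h⟩ := exists_norm_le_mul_re hz
  have h0 := h 0
  rw [Nat.cast_zero, add_zero] at h0
  have hS : Differentiable ℂ fun s =>
      ∑' l : ℤ, 1 / (l : ℂ) * tricomiOne s (-2 * Real.pi * I * l * z) := by
    intro s₀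
    obtain ⟨C, hC⟩ := exists_norm_tricomiOne_le K (‖s₀‖ + 1) ⌈‖s₀‖ + 2⌉₊ hK
    refine (differentiableOn_tsum_of_summable_norm
      ((Real.summable_one_div_int_pow.mpr one_lt_two).mul_left C) (fun l => ?_)
      Metric.isOpen_ball (fun l s hs => ?_)).differentiableAt (Metric.ball_mem_nhds s₀ one_pos)
    · rcases eq_or_ne l 0 with rfl | hl
      · simp
      · exact ((differentiable_tricomiOne_left
          (neg_two_pi_I_mul_im_ne_zero hl hz)).const_mul _).differentiableOn
    · have h2 : ‖s - s₀‖ < 1 := by simpa [dist_eq] using hs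
      have h3 := norm_le_norm_add_norm_sub' s s₀
      have h4 := abs_re_le_norm s
      have h5 := abs_im_le_norm s
      have h6 := abs_add_le s.re 1
      rw [abs_one] at h6
      exact hC s z l hz h0.1 h0.2 (le_trans (by linarith) (Nat.le_ceil _)) (by linarith)
  intro s hs
  have hs1 : s - 1 ≠ 0 := sub_ne_zero.mpr hs
  have hc : ∀ f : ℂ → ℂ, Differentiable ℂ f → DifferentiableAt ℂ (fun s => z ^ f s) s :=
    fun f hf => (hf s).const_cpow (Or.inl hz0)
  have h1 := hc (fun s => 1 - s) (by fun_prop)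
  have h2 := hc (fun s => -s) (by fun_prop)
  refine DifferentiableAt.differentiableWithinAt ?_
  exact ((h1.div (by fun_prop) hs1).add (h2.div_const 2)).add
    (((differentiableAt_id.mul h2).div_const _).mul (hS s))

end

/-- for `Re z > 0` and `s` not a positive integer, the (analytically
continued) Hurwitz zeta function satisfies
`ζ(s,z) = z^{1-s}/(s-1) + z^{-s}/2 + (s z^{-s}/(2πi)) Σ_{l≠0} (1/l) U(1,1-s;-2πilz)`,
where `U` is Tricomi's confluent hypergeometric function `U(1,1-s;·)`, characterized
as the analytic continuation (in `x`, through the slit plane) of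
`∫_0^∞ e^{-xu}(1+u)^{-s-1} du`. -/
theorem hurwitzZeta_tricomi_expansion (z : ℂ) (hz : 0 < z.re)
    (Z : ℂ → ℂ)
    (hZanal : DifferentiableOn ℂ Z {s : ℂ | s ≠ 1})
    (hZser : ∀ s : ℂ, 1 < s.re → Z s = ∑' k : ℕ, ((k : ℂ) + z) ^ (-s))
    (U : ℂ → ℂ → ℂ)
    (hUanal : ∀ s : ℂ, DifferentiableOn ℂ (U s) Complex.slitPlane)
    (hUint : ∀ s x : ℂ, 0 < x.re →
      U s x = ∫ u in Set.Ioi (0 : ℝ), Complex.exp (-x * u) * ((1 : ℂ) + u) ^ (-s - 1))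
    (s : ℂ) (hs : ¬∃ n : ℕ, s = (n : ℂ) + 1) :
    Z s = z ^ (1 - s) / (s - 1) + z ^ (-s) / 2 +
      (s * z ^ (-s) / (2 * Real.pi * I)) *
        ∑' l : {l : ℤ // l ≠ 0},
          (1 / (l : ℂ)) * U s (-2 * Real.pi * I * l * z) := by
  have hs1 : s ≠ 1 := fun h => hs ⟨0, by simp [h]⟩
  have hopen : IsOpen {s : ℂ | s ≠ 1} := isOpen_ne
  have hconn : IsPreconnected {s : ℂ | s ≠ 1} :=
    (isConnected_compl_singleton_of_one_lt_rank (by simp) 1).isPreconnected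
  have hZ : Z s = tricomiExpansion s z := by
    refine (hZanal.analyticOnNhd hopen).eqOn_of_preconnected_of_eventuallyEq
      ((differentiableOn_tricomiExpansion hz).analyticOnNhd hopen) hconn
      (z₀ := 2) (by simp) ?_ hs1
    filter_upwards [(isOpen_lt continuous_const continuous_re).mem_nhds
      (show (1 : ℝ) < (2 : ℂ).re by simp)] with w hw
    rw [hZser w hw, tsum_natCast_add_cpow_eq_tricomiExpansion hz hw]
  have hU := eqOn_tricomiOne (hUanal s) (hUint s)
  have hsupp : Function.support
      (fun l : ℤ => 1 / (l : ℂ) * tricomiOne s (-2 * Real.pi * I * l * z)) ⊆ {l : ℤ | l ≠ 0} := by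
    rintro l hl rfl
    simp at hl
  rw [hZ, tricomiExpansion, ← tsum_subtype_eq_of_support_subset hsupp]
  congr 2
  refine tsum_congr fun l => ?_
  rw [hU (Or.inr (neg_two_pi_I_mul_im_ne_zero l.2 hz))]
end

section
/- For every nonzero integer l, with δ = 2πi/log q, one has lim_{q→1⁻} (1-q)^s Γ(s+δl)/Γ(δl) = (-2πil)^s, for any fixed complex s, where (-2πil)^s is the principal-branch power. -/
open Complex

open Filter Topology

theorem mul_cpow_of_re_nonneg_of_re_pos {a b : ℂ} (ha : 0 ≤ a.re) (ha0 : a ≠ 0) (hb : 0 < b.re)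
    (s : ℂ) : (a * b) ^ s = a ^ s * b ^ s := by
  have hb0 : b ≠ 0 := by
    rintro rfl
    simp at hb
  have h₁ := abs_le.1 (abs_arg_le_pi_div_two_iff.2 ha)
  have h₂ := abs_lt.1 (abs_arg_lt_pi_div_two_iff.2 (Or.inl hb))
  rw [cpow_def_of_ne_zero (mul_ne_zero ha0 hb0), cpow_def_of_ne_zero ha0,
    cpow_def_of_ne_zero hb0, log_mul ha0 hb0 ⟨by linarith, by linarith⟩, add_mul, exp_add]

theorem Gamma_add_natCast_eq_prod_mul {z : ℂ} (hz : ∀ m : ℕ, z ≠ -m) (n : ℕ) :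
    Gamma (z + n) = (∏ j ∈ Finset.range n, (z + j)) * Gamma z := by
  induction n with
  | zero => simp
  | succ n ih =>
    have h : z + n ≠ 0 := fun h => hz n (eq_neg_of_add_eq_zero_left h)
    rw [Nat.cast_succ, ← add_assoc, Gamma_add_one _ h, ih, Finset.prod_range_succ]
    ring

theorem tendsto_Gamma_add_natCast_div {z : ℂ} (hz : ∀ m : ℕ, z ≠ -m) :
    Tendsto (fun n : ℕ => Gamma (z + (n + 1 : ℕ)) / ((n : ℂ) ^ z * n.factorial)) atTop (𝓝 1) := by
  have hG := Gamma_ne_zero hz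
  have h := (tendsto_const_nhds (x := Gamma z)).div (GammaSeq_tendsto_Gamma z) hG
  rw [div_self hG] at h
  refine h.congr fun n => ?_
  rw [Gamma_add_natCast_eq_prod_mul hz, Pi.div_apply, GammaSeq, div_div_eq_mul_div, mul_comm]

theorem re_nonneg_add_natCast {z : ℂ} (hz : 0 ≤ z.re) (k : ℕ) : 0 ≤ (z + k).re := by
  simp only [add_re, natCast_re]
  positivity

theorem norm_sq_add_natCast_ge {z : ℂ} (hz : 0 ≤ z.re) (k : ℕ) :
    ‖z‖ ^ 2 + (k : ℝ) ^ 2 ≤ ‖z + k‖ ^ 2 := by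
  rw [← normSq_eq_norm_sq, ← normSq_eq_norm_sq, normSq_apply, normSq_apply]
  simp only [add_re, natCast_re, add_im, natCast_im]
  nlinarith [mul_nonneg hz k.cast_nonneg]

theorem norm_le_norm_add_natCast {z : ℂ} (hz : 0 ≤ z.re) (k : ℕ) : ‖z‖ ≤ ‖z + k‖ :=
  (sq_le_sq₀ (norm_nonneg _) (norm_nonneg _)).1
    (by nlinarith [norm_sq_add_natCast_ge hz k, sq_nonneg (k : ℝ)])

theorem ne_neg_natCast_of_norm_lt {z s : ℂ} (hz : 0 ≤ z.re) (hs : ‖s‖ < ‖z‖) (m : ℕ) :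
    z + s ≠ -m := by
  intro h
  have h₁ : z + m = -s := by linear_combination h
  have h₂ := norm_le_norm_add_natCast hz m
  rw [h₁, norm_neg] at h₂
  linarith

theorem re_one_add_inv_pos {z : ℂ} (hz : 0 ≤ z.re) : 0 < (1 + z⁻¹).re := by
  rw [add_re, one_re, inv_re]
  have := div_nonneg hz (normSq_nonneg z)
  linarith

/-- The ratio `Γ(z + s) / (Γ(z) z ^ s)`, which tends to `1` at infinity in the right half plane. -/
noncomputable def gammaRatio (s z : ℂ) : ℂ := Gamma (z + s) / (Gamma z * z ^ s)

/-- A logarithm of `gammaRatio s (z + 1) / gammaRatio s z`. -/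
noncomputable def logGammaRatioStep (s z : ℂ) : ℂ := log (1 + s / z) - s * log (1 + z⁻¹)

theorem gammaRatio_add_one {s z : ℂ} (hz : 0 ≤ z.re) (hs : ‖s‖ < ‖z‖) :
    gammaRatio s (z + 1) = gammaRatio s z * exp (logGammaRatioStep s z) := by
  have hz0 : z ≠ 0 := norm_pos_iff.1 ((norm_nonneg s).trans_lt hs)
  have hzs : z + s ≠ 0 := by simpa using ne_neg_natCast_of_norm_lt hz hs 0
  have hone : 1 + z⁻¹ ≠ 0 := by
    intro h
    simpa [h] using re_one_add_inv_pos hz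
  have hdiv : 1 + s / z ≠ 0 := by
    rw [one_add_div hz0]
    exact div_ne_zero hzs hz0
  have hpow : (z + 1) ^ s = z ^ s * (1 + z⁻¹) ^ s := by
    rw [← mul_cpow_of_re_nonneg_of_re_pos hz hz0 (re_one_add_inv_pos hz), mul_add, mul_one,
      mul_inv_cancel₀ hz0]
  rw [gammaRatio, gammaRatio, logGammaRatioStep, add_right_comm, Gamma_add_one _ hzs,
    Gamma_add_one _ hz0, hpow, exp_sub, exp_log hdiv, cpow_def_of_ne_zero hone, mul_comm s (log _),
    one_add_div hz0]
  simp only [div_eq_mul_inv, mul_inv]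
  ring

theorem gammaRatio_add_natCast {s z : ℂ} (hz : 0 ≤ z.re) (hs : ‖s‖ < ‖z‖) (n : ℕ) :
    gammaRatio s (z + n) =
      gammaRatio s z * exp (∑ k ∈ Finset.range n, logGammaRatioStep s (z + k)) := by
  induction n with
  | zero => simp
  | succ n ih =>
    rw [Nat.cast_succ, ← add_assoc, gammaRatio_add_one (re_nonneg_add_natCast hz n)
      (hs.trans_le (norm_le_norm_add_natCast hz n)), ih, Finset.sum_range_succ, exp_add, mul_assoc]

theorem norm_logGammaRatioStep_le {s z : ℂ} (hs : 2 * (‖s‖ + 1) ≤ ‖z‖) :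
    ‖logGammaRatioStep s z‖ ≤ (‖s‖ ^ 2 + ‖s‖) / ‖z‖ ^ 2 := by
  have hs0 := norm_nonneg s
  have hz : 0 < ‖z‖ := by linarith
  have key (w : ℂ) (hw : ‖w‖ ≤ 1 / 2) : ‖log (1 + w) - w‖ ≤ ‖w‖ ^ 2 := by
    refine (norm_log_one_add_sub_self_le (hw.trans_lt (by norm_num))).trans ?_
    have h : (1 - ‖w‖)⁻¹ ≤ 2 := inv_le_of_inv_le₀ (by norm_num) (by linarith)
    nlinarith [mul_le_mul_of_nonneg_left h (sq_nonneg ‖w‖)]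
  have h₁ := key (s / z) (by rw [norm_div, div_le_iff₀ hz]; linarith)
  have h₂ := key z⁻¹ (by rw [norm_inv, inv_le_comm₀ hz (by norm_num)]; linarith)
  have heq : logGammaRatioStep s z =
      (log (1 + s / z) - s / z) - s * (log (1 + z⁻¹) - z⁻¹) := by
    rw [logGammaRatioStep, div_eq_mul_inv]
    ring
  calc ‖logGammaRatioStep s z‖
      ≤ ‖log (1 + s / z) - s / z‖ + ‖s‖ * ‖log (1 + z⁻¹) - z⁻¹‖ := by
        rw [heq, ← norm_mul]
        exact norm_sub_le _ _
    _ ≤ ‖s / z‖ ^ 2 + ‖s‖ * ‖z⁻¹‖ ^ 2 := by gcongr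
    _ = (‖s‖ ^ 2 + ‖s‖) / ‖z‖ ^ 2 := by
        rw [norm_div, norm_inv]
        ring

theorem norm_logGammaRatioStep_add_natCast_le {s z : ℂ} (hz : 0 ≤ z.re)
    (hs : 2 * (‖s‖ + 1) ≤ ‖z‖) (k : ℕ) :
    ‖logGammaRatioStep s (z + k)‖ ≤ (‖s‖ ^ 2 + ‖s‖) * (2 * (((k + 1 : ℕ) : ℝ) ^ 2)⁻¹) := by
  have hs0 := norm_nonneg s
  refine (norm_logGammaRatioStep_le (hs.trans (norm_le_norm_add_natCast hz k))).trans ?_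
  rw [div_eq_mul_inv]
  gcongr
  rw [← div_eq_mul_inv, ← inv_div]
  apply inv_anti₀ (by positivity)
  have := norm_sq_add_natCast_ge hz k
  push_cast
  nlinarith [sq_nonneg ((k : ℝ) - 1)]

theorem summable_succ_sq_inv (C : ℝ) :
    Summable fun k : ℕ => C * (2 * (((k + 1 : ℕ) : ℝ) ^ 2)⁻¹) :=
  (((summable_nat_add_iff 1).2 (Real.summable_nat_pow_inv.2 one_lt_two)).mul_left 2).mul_left C

theorem tendsto_gammaRatio_add_natCast {s z : ℂ} (hz : 0 ≤ z.re) (hs : ‖s‖ < ‖z‖) :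
    Tendsto (fun n : ℕ => gammaRatio s (z + n)) atTop (𝓝 1) := by
  rw [← tendsto_add_atTop_iff_nat 1]
  have hz' : ∀ m : ℕ, z ≠ -m := by
    have hz0 : ‖(0 : ℂ)‖ < ‖z‖ := by simpa using (norm_nonneg s).trans_lt hs
    simpa using ne_neg_natCast_of_norm_lt hz hz0
  have h₁ := (tendsto_Gamma_add_natCast_div (ne_neg_natCast_of_norm_lt hz hs)).div
    (tendsto_Gamma_add_natCast_div hz') one_ne_zero
  have h₂ : Tendsto (fun n : ℕ => (1 + (z + 1) / (n : ℂ)) ^ s) atTop (𝓝 1) := by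
    have h : Tendsto (fun n : ℕ => 1 + (z + 1) / (n : ℂ)) atTop (𝓝 1) := by
      simpa using (tendsto_const_nhds (x := (1 : ℂ))).add
        (tendsto_const_div_atTop_nhds_zero_nat (z + 1))
    simpa using h.cpow (tendsto_const_nhds (x := s)) one_mem_slitPlane
  have h₃ := h₁.div h₂ one_ne_zero
  simp only [div_one] at h₃
  refine h₃.congr' ?_
  filter_upwards [eventually_ne_atTop 0] with n hn
  have hn0 : (n : ℂ) ≠ 0 := Nat.cast_ne_zero.2 hn
  have hpow : (z + (n + 1 : ℕ)) ^ s = (n : ℂ) ^ s * (1 + (z + 1) / n) ^ s := by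
    rw [← mul_cpow_of_re_nonneg_of_re_pos (by simp) hn0]
    · congr 1
      push_cast
      field_simp
      ring
    · rw [add_re, one_re, div_natCast_re, add_re, one_re]
      positivity
  have hnz : (n : ℂ) ^ z ≠ 0 := by simp [cpow_eq_zero_iff, hn]
  have hfac : (n.factorial : ℂ) ≠ 0 := Nat.cast_ne_zero.2 n.factorial_ne_zero
  simp only [Pi.div_apply]
  rw [gammaRatio, hpow, cpow_add _ _ hn0, add_right_comm z s]
  field_simp

theorem gammaRatio_eq_exp_neg_tsum {s z : ℂ} (hz : 0 ≤ z.re) (hs : 2 * (‖s‖ + 1) ≤ ‖z‖) :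
    gammaRatio s z = exp (-∑' k : ℕ, logGammaRatioStep s (z + k)) := by
  have hlt : ‖s‖ < ‖z‖ := by linarith [norm_nonneg s]
  have hsum : Summable fun k : ℕ => logGammaRatioStep s (z + k) :=
    .of_norm_bounded (summable_succ_sq_inv _) (norm_logGammaRatioStep_add_natCast_le hz hs)
  have h := (hsum.hasSum.tendsto_sum_nat.cexp).const_mul (gammaRatio s z)
  simp only [← gammaRatio_add_natCast hz hlt] at h
  rw [exp_neg]
  exact eq_inv_of_mul_eq_one_left
    (tendsto_nhds_unique h (tendsto_gammaRatio_add_natCast hz hlt))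

/-- `Γ(z + s) ∼ Γ(z) z ^ s` as `z → ∞` in the closed right half plane. -/
theorem tendsto_gammaRatio_cobounded (s : ℂ) :
    Tendsto (gammaRatio s) (Bornology.cobounded ℂ ⊓ 𝓟 {z | 0 ≤ z.re}) (𝓝 1) := by
  have hre : ∀ᶠ z : ℂ in Bornology.cobounded ℂ ⊓ 𝓟 {z | 0 ≤ z.re}, 0 ≤ z.re :=
    mem_inf_of_right (mem_principal_self _)
  have hnorm : Tendsto (fun z : ℂ => ‖z‖) (Bornology.cobounded ℂ ⊓ 𝓟 {z | 0 ≤ z.re}) atTop :=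
    tendsto_norm_cobounded_atTop.mono_left inf_le_left
  have hlarge := hnorm.eventually_ge_atTop (2 * (‖s‖ + 1))
  have hsum : Tendsto (fun z : ℂ => ∑' k : ℕ, logGammaRatioStep s (z + k))
      (Bornology.cobounded ℂ ⊓ 𝓟 {z | 0 ≤ z.re}) (𝓝 (∑' _ : ℕ, 0)) := by
    refine tendsto_tsum_of_dominated_convergence (summable_succ_sq_inv (‖s‖ ^ 2 + ‖s‖))
      (fun k => ?_) ?_
    · have hlim : Tendsto (fun z : ℂ => (‖s‖ ^ 2 + ‖s‖) / ‖z‖ ^ 2)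
          (Bornology.cobounded ℂ ⊓ 𝓟 {z | 0 ≤ z.re}) (𝓝 0) :=
        ((tendsto_pow_atTop two_ne_zero).comp hnorm).const_div_atTop _
      refine squeeze_zero_norm' ?_ hlim
      filter_upwards [hre, hlarge] with z hz hs
      have hle := norm_le_norm_add_natCast hz k
      refine (norm_logGammaRatioStep_le (hs.trans hle)).trans ?_
      have : 0 < ‖z‖ := by linarith [norm_nonneg s]
      gcongr
    · filter_upwards [hre, hlarge] with z hz hs using norm_logGammaRatioStep_add_natCast_le hz hs
  have h := hsum.neg.cexp
  rw [tsum_zero, neg_zero, exp_zero] at h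
  refine h.congr' ?_
  filter_upwards [hre, hlarge] with z hz hs using (gammaRatio_eq_exp_neg_tsum hz hs).symm

theorem tendsto_one_sub_div_log :
    Tendsto (fun q : ℝ => (1 - q) / Real.log q) (𝓝[Set.Ioo 0 1] 1) (𝓝 (-1)) := by
  have h := (hasDerivAt_iff_tendsto_slope.1 (Real.hasDerivAt_log one_ne_zero)).mono_left
    (nhdsWithin_mono (1 : ℝ) fun q (hq : q ∈ Set.Ioo (0 : ℝ) 1) => hq.2.ne)
  have h' := (h.inv₀ (by simp)).neg
  rw [inv_one, inv_one] at h'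
  refine h'.congr fun q => ?_
  rw [slope_def_field, Real.log_one, sub_zero, inv_div, ← neg_div, neg_sub]

/-- with `δ = 2πi/log q`, for any fixed `s ∈ ℂ` and nonzero integer `l`,
`lim_{q→1⁻} (1-q)^s Γ(s+δl)/Γ(δl) = (-2πil)^s` (principal branch). -/
theorem gamma_ratio_classical_limit (l : ℤ) (hl : l ≠ 0) (s : ℂ) :
    Filter.Tendsto
      (fun q : ℝ =>
        ((1 : ℂ) - q) ^ s *
          Complex.Gamma (s + (2 * Real.pi * I / Real.log q) * l) /
          Complex.Gamma ((2 * Real.pi * I / Real.log q) * l))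
      (nhdsWithin 1 (Set.Ioo (0 : ℝ) 1))
      (nhds ((-2 * Real.pi * I * l) ^ s)) := by
  have hc : (2 * Real.pi * I * l : ℂ) ≠ 0 := by simp [hl, Real.pi_ne_zero]
  have hform (q : ℝ) : (2 * Real.pi * I / Real.log q) * l =
      ((Real.log q)⁻¹ : ℝ) * (2 * Real.pi * I * l : ℂ) := by
    push_cast
    ring
  have hlog : Tendsto Real.log (𝓝[Set.Ioo 0 1] 1) (𝓝[≠] 0) := by
    refine tendsto_nhdsWithin_iff.2 ⟨?_, ?_⟩
    · simpa using (Real.continuousAt_log one_ne_zero).tendsto.mono_left nhdsWithin_le_nhds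
    · filter_upwards [self_mem_nhdsWithin] with q hq using (Real.log_neg hq.1 hq.2).ne
  have hδ : Tendsto (fun q : ℝ => (2 * Real.pi * I / Real.log q) * l : ℝ → ℂ)
      (𝓝[Set.Ioo 0 1] 1) (Bornology.cobounded ℂ ⊓ 𝓟 {z | 0 ≤ z.re}) := by
    refine tendsto_inf.2 ⟨?_, tendsto_principal.2 (Eventually.of_forall fun q => ?_)⟩
    · rw [← tendsto_norm_atTop_iff_cobounded]
      simp only [hform, norm_mul, norm_real]
      exact (tendsto_norm_cobounded_atTop.comp
        (tendsto_inv₀_nhdsNE_zero.comp hlog)).atTop_mul_const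
        (by simpa only [norm_mul, norm_real] using norm_pos_iff.2 hc)
    · simp [hform]
  have hbase : Tendsto (fun q : ℝ => ((1 - q : ℝ) : ℂ) * ((2 * Real.pi * I / Real.log q) * l))
      (𝓝[Set.Ioo 0 1] 1) (𝓝 (-2 * Real.pi * I * l)) := by
    have h := ((continuous_ofReal.tendsto _).comp tendsto_one_sub_div_log).mul_const
      (2 * Real.pi * I * l : ℂ)
    convert h using 2
    · simp only [Function.comp_apply]
      push_cast
      ring
    · push_cast
      ring
  have hslit : (-2 * Real.pi * I * l : ℂ) ∈ slitPlane := by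
    right
    simp [hl, Real.pi_ne_zero]
  have h := (hbase.cpow (tendsto_const_nhds (x := s)) hslit).mul
    ((tendsto_gammaRatio_cobounded s).comp hδ)
  rw [mul_one] at h
  refine h.congr' ?_
  filter_upwards [self_mem_nhdsWithin] with q hq
  have hw : (2 * Real.pi * I / Real.log q) * l ≠ (0 : ℂ) := by
    rw [hform]
    exact mul_ne_zero (ofReal_ne_zero.2 (inv_ne_zero (Real.log_neg hq.1 hq.2).ne)) hc
  have hwre : 0 ≤ ((2 * Real.pi * I / Real.log q) * l : ℂ).re := by simp [hform]
  rw [Function.comp_apply, gammaRatio, mul_comm ((1 - q : ℝ) : ℂ),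
    mul_cpow_of_re_nonneg_of_re_pos hwre hw (by simpa using hq.2), add_comm _ s]
  have hws := (cpow_ne_zero_iff (y := s)).2 (Or.inl hw)
  rw [ofReal_sub, ofReal_one]
  generalize (2 * Real.pi * I / Real.log q * l : ℂ) = w at hws
  field_simp
end

section
/- For a, b positive reals, as q → 1⁻ one has log (q^a : q^b)_∞ = π²/(6b log q) + (1/2 - a/b)(log(-log q) + log b) + (1/2) log(2π) - log Γ(a/b) + O(log q). -/
open Filter Topology Set

/-- The error of the trapezoidal rule for a convex function `h` on `[u, v]`, where `Ψ' = h` and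
`h' = k`. -/
theorem abs_trapezoid_sub_integral_le {Ψ h k : ℝ → ℝ} {u v : ℝ} (huv : u < v)
    (hΨ : ∀ x ∈ Icc u v, HasDerivAt Ψ (h x) x) (hh : ∀ x ∈ Icc u v, HasDerivAt h (k x) x)
    (hk : MonotoneOn k (Icc u v)) :
    |(h u + h v) / 2 * (v - u) - (Ψ v - Ψ u)| ≤ (v - u) ^ 2 / 2 * (k v - k u) := by
  have hu : u ∈ Icc u v := left_mem_Icc.2 huv.le
  have hv : v ∈ Icc u v := right_mem_Icc.2 huv.le
  have bounds : ∀ x ∈ Ioc u v,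
      h u + (x - u) * k u ≤ h x ∧ h x ≤ h u + (x - u) * k v := by
    intro x hx
    have hsub : Icc u x ⊆ Icc u v := Icc_subset_Icc_right hx.2
    obtain ⟨ξ, hξ, e⟩ := exists_hasDerivAt_eq_slope h k hx.1
      (fun y hy => (hh y (hsub hy)).continuousAt.continuousWithinAt)
      (fun y hy => hh y (hsub (Ioo_subset_Icc_self hy)))
    have hξ' := hsub (Ioo_subset_Icc_self hξ)
    have hpos : 0 < x - u := sub_pos.2 hx.1
    rw [eq_div_iff hpos.ne'] at e
    have h1 := mul_le_mul_of_nonneg_right (hk hu hξ' hξ'.1) hpos.le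
    have h2 := mul_le_mul_of_nonneg_right (hk hξ' hv hξ'.2) hpos.le
    constructor <;> linarith
  have key : ∀ m : ℝ, ∃ ξ ∈ Ioo u v,
      (h ξ - h u - (ξ - u) * m) * (v - u) =
        Ψ v - Ψ u - h u * (v - u) - (v - u) ^ 2 / 2 * m := by
    intro m
    have hd : ∀ x ∈ Icc u v, HasDerivAt
        (fun x => Ψ x - h u * (x - u) - (x - u) ^ 2 / 2 * m) (h x - h u - (x - u) * m) x := by
      intro x hx
      have h1 : HasDerivAt (fun x => x - u) 1 x := (hasDerivAt_id x).sub_const u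
      refine (((hΨ x hx).sub (h1.const_mul (h u))).sub
        (((h1.pow 2).div_const 2).mul_const m)).congr_deriv ?_
      norm_num
    obtain ⟨ξ, hξ, e⟩ := exists_hasDerivAt_eq_slope _ _ huv
      (fun y hy => (hd y hy).continuousAt.continuousWithinAt)
      (fun y hy => hd y (Ioo_subset_Icc_self hy))
    refine ⟨ξ, hξ, ?_⟩
    rw [eq_div_iff (sub_pos.2 huv).ne'] at e
    rw [e]
    ring
  have hpos : 0 < v - u := sub_pos.2 huv
  obtain ⟨ξ, hξ, e⟩ := key (k u)
  obtain ⟨η, hη, e'⟩ := key (k v)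
  have h1 := mul_nonneg (sub_nonneg.2 (bounds ξ ⟨hξ.1, hξ.2.le⟩).1) hpos.le
  have h2 := mul_nonneg (sub_nonneg.2 (bounds η ⟨hη.1, hη.2.le⟩).2) hpos.le
  have h3 := mul_nonneg (sub_nonneg.2 (bounds v ⟨huv, le_rfl⟩).1) hpos.le
  have h4 := mul_nonneg (sub_nonneg.2 (bounds v ⟨huv, le_rfl⟩).2) hpos.le
  rw [abs_le]
  constructor <;> nlinarith

/-- The dilogarithm `Li₂` evaluated at `exp (-y)`. -/
noncomputable def dilogExpNeg (y : ℝ) : ℝ :=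
  ∑' n : ℕ, Real.exp (-((n + 1) * y)) / ((n : ℝ) + 1) ^ 2

theorem hasSum_one_div_succ_sq :
    HasSum (fun n : ℕ => 1 / ((n : ℝ) + 1) ^ 2) (Real.pi ^ 2 / 6) := by
  have := (hasSum_nat_add_iff' 1).2 hasSum_zeta_two
  simpa using this

theorem exp_neg_succ_mul_div_sq_le {y : ℝ} (hy : 0 ≤ y) (n : ℕ) :
    Real.exp (-((n + 1) * y)) / ((n : ℝ) + 1) ^ 2 ≤
      Real.exp (-y) * (1 / ((n : ℝ) + 1) ^ 2) := by
  rw [mul_one_div]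
  gcongr
  nlinarith [mul_nonneg n.cast_nonneg hy]

theorem summable_dilogExpNeg {y : ℝ} (hy : 0 ≤ y) :
    Summable fun n : ℕ => Real.exp (-((n + 1) * y)) / ((n : ℝ) + 1) ^ 2 :=
  .of_nonneg_of_le (fun n => by positivity) (exp_neg_succ_mul_div_sq_le hy)
    (hasSum_one_div_succ_sq.summable.mul_left _)

theorem dilogExpNeg_zero : dilogExpNeg 0 = Real.pi ^ 2 / 6 := by
  simpa [dilogExpNeg] using hasSum_one_div_succ_sq.tsum_eq

theorem tendsto_dilogExpNeg_atTop : Tendsto dilogExpNeg atTop (𝓝 0) := by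
  have hlim : Tendsto (fun y : ℝ => Real.exp (-y) * (Real.pi ^ 2 / 6)) atTop (𝓝 0) := by
    simpa using Real.tendsto_exp_neg_atTop_nhds_zero.mul_const (Real.pi ^ 2 / 6)
  refine squeeze_zero' (.of_forall fun y => tsum_nonneg fun n => by positivity) ?_ hlim
  filter_upwards [eventually_ge_atTop 0] with y hy
  exact hasSum_le (exp_neg_succ_mul_div_sq_le hy) (summable_dilogExpNeg hy).hasSum
    (hasSum_one_div_succ_sq.mul_left _)

theorem continuousOn_dilogExpNeg : ContinuousOn dilogExpNeg (Ici 0) := by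
  refine continuousOn_tsum (fun n => by fun_prop) hasSum_one_div_succ_sq.summable ?_
  intro n y hy
  rw [Real.norm_of_nonneg (by positivity)]
  refine (exp_neg_succ_mul_div_sq_le hy n).trans (mul_le_of_le_one_left (by positivity) ?_)
  simpa using hy

theorem hasDerivAt_dilogExpNeg {y : ℝ} (hy : 0 < y) :
    HasDerivAt dilogExpNeg (Real.log (1 - Real.exp (-y))) y := by
  have hsum : ∑' n : ℕ, -(Real.exp (-((n + 1) * y)) / ((n : ℝ) + 1)) =
      Real.log (1 - Real.exp (-y)) := by
    have hlt : |Real.exp (-y)| < 1 := by simpa [abs_of_pos (Real.exp_pos _)] using hy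
    have := (Real.hasSum_pow_div_log_of_abs_lt_one hlt).neg
    rw [neg_neg] at this
    rw [← this.tsum_eq]
    refine tsum_congr fun n => ?_
    rw [← Real.exp_nat_mul]
    push_cast
    ring_nf
  rw [← hsum]
  refine hasDerivAt_tsum_of_isPreconnected
    (g := fun (n : ℕ) (y : ℝ) => Real.exp (-((n + 1) * y)) / ((n : ℝ) + 1) ^ 2)
    (g' := fun (n : ℕ) (y : ℝ) => -(Real.exp (-((n + 1) * y)) / ((n : ℝ) + 1))) (u := fun n : ℕ => Real.exp (-(y / 2)) ^ n)
    (summable_geometric_of_lt_one (by positivity) (by simpa using hy)) isOpen_Ioi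
    isPreconnected_Ioi (t := Ioi (y / 2)) ?_ ?_ (half_lt_self hy)
    (summable_dilogExpNeg hy.le) (half_lt_self hy)
  · intro n z _
    have h1 : HasDerivAt (fun z : ℝ => -(((n : ℝ) + 1) * z)) (-((n : ℝ) + 1)) z :=
      ((hasDerivAt_id z).const_mul ((n : ℝ) + 1)).neg.congr_deriv (by rw [mul_one])
    refine (h1.exp.div_const (((n : ℝ) + 1) ^ 2)).congr_deriv ?_
    field_simp
  · intro n z hz
    have hz : y / 2 < z := hz
    rw [norm_neg, Real.norm_of_nonneg (by positivity), ← Real.exp_nat_mul]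
    refine (div_le_self (by positivity) (by linarith [n.cast_nonneg (α := ℝ)])).trans ?_
    gcongr
    nlinarith [n.cast_nonneg (α := ℝ), mul_nonneg n.cast_nonneg (sub_nonneg.2 hz.le)]

theorem hasDerivAt_mul_log_sub_self {y : ℝ} (hy : 0 < y) :
    HasDerivAt (fun y => y * Real.log y - y) (Real.log y) y :=
  ((Real.hasDerivAt_mul_log hy.ne').sub (hasDerivAt_id y)).congr_deriv (add_sub_cancel_right _ _)

theorem one_sub_exp_neg_pos {y : ℝ} (hy : 0 < y) : 0 < 1 - Real.exp (-y) := by simpa using hy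

theorem hasDerivAt_log_one_sub_exp_neg_sub_log {y : ℝ} (hy : 0 < y) :
    HasDerivAt (fun y => Real.log (1 - Real.exp (-y)) - Real.log y)
      ((Real.exp y - 1)⁻¹ - y⁻¹) y := by
  have h1 : HasDerivAt (fun y : ℝ => 1 - Real.exp (-y)) (Real.exp (-y)) y := by
    simpa using ((hasDerivAt_neg y).exp).const_sub 1
  refine ((h1.log (one_sub_exp_neg_pos hy).ne').sub (Real.hasDerivAt_log hy.ne')).congr_deriv ?_
  have h2 := (one_sub_exp_neg_pos hy).ne'
  have h3 : Real.exp y - 1 ≠ 0 := by simpa [sub_eq_zero] using hy.ne'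
  congr 1
  rw [inv_eq_one_div, div_eq_div_iff h2 h3, mul_sub, ← Real.exp_add]
  simp

theorem monotoneOn_inv_exp_sub_one_sub_inv :
    MonotoneOn (fun y : ℝ => (Real.exp y - 1)⁻¹ - y⁻¹) (Ioi 0) := by
  have hd : ∀ y : ℝ, 0 < y → HasDerivAt (fun y : ℝ => (Real.exp y - 1)⁻¹ - y⁻¹)
      (-Real.exp y / (Real.exp y - 1) ^ 2 - -(y ^ 2)⁻¹) y := by
    intro y hy
    have h3 : Real.exp y - 1 ≠ 0 := by simpa [sub_eq_zero] using hy.ne'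
    exact (((Real.hasDerivAt_exp y).sub_const 1).inv h3).sub (hasDerivAt_inv hy.ne')
  refine monotoneOn_of_deriv_nonneg (convex_Ioi 0)
    (fun y hy => (hd y hy).continuousAt.continuousWithinAt) ?_ ?_
  · rw [interior_Ioi]
    exact fun y hy => (hd y hy).differentiableAt.differentiableWithinAt
  · rw [interior_Ioi]
    intro y hy
    have hy : 0 < y := hy
    rw [(hd y hy).deriv]
    have h3 : 0 < Real.exp y - 1 := by simpa using hy
    have h4 : y / 2 ≤ Real.sinh (y / 2) := Real.self_le_sinh_iff.2 (by positivity)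
    rw [Real.sinh_eq] at h4
    have h5 : y * Real.exp (y / 2) ≤ Real.exp y - 1 := by
      have : Real.exp y = Real.exp (y / 2) * Real.exp (y / 2) := by
        rw [← Real.exp_add]; ring_nf
      have h6 : Real.exp (-(y / 2)) * Real.exp (y / 2) = 1 := by
        rw [← Real.exp_add]; simp
      nlinarith [Real.exp_pos (y / 2)]
    have h7 : y ^ 2 * Real.exp y ≤ (Real.exp y - 1) ^ 2 := by
      have : y ^ 2 * Real.exp y = (y * Real.exp (y / 2)) ^ 2 := by
        rw [mul_pow, ← Real.exp_nat_mul]; ring_nf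
      rw [this]
      gcongr
    rw [sub_neg_eq_add, neg_div, neg_add_eq_sub, sub_nonneg, ← one_div,
      div_le_div_iff₀ (by positivity) (by positivity)]
    linarith

theorem inv_exp_sub_one_sub_inv_nonpos {y : ℝ} (hy : 0 < y) :
    (Real.exp y - 1)⁻¹ - y⁻¹ ≤ 0 := by
  rw [sub_nonpos]
  gcongr
  linarith [Real.add_one_le_exp y]

theorem neg_one_le_inv_exp_sub_one_sub_inv {y : ℝ} (hy : 0 < y) :
    -1 ≤ (Real.exp y - 1)⁻¹ - y⁻¹ := by
  have h1 := one_sub_exp_neg_pos hy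
  have h2 : 1 - Real.exp (-y) ≤ y := by linarith [Real.add_one_le_exp (-y)]
  have h3 : (Real.exp y - 1)⁻¹ + 1 = (1 - Real.exp (-y))⁻¹ := by
    have h4 : Real.exp y - 1 ≠ 0 := by simpa [sub_eq_zero] using hy.ne'
    have h5 : Real.exp y * Real.exp (-y) = 1 := by rw [← Real.exp_add]; simp
    rw [← mul_eq_one_iff_eq_inv₀ h1.ne', inv_eq_one_div, div_add_one h4, div_mul_eq_mul_div,
      div_eq_one_iff_eq h4]
    linear_combination -h5
  have := inv_anti₀ h1 h2
  linarith

theorem abs_log_one_sub_exp_neg_sub_log_le {y : ℝ} (hy : 0 < y) :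
    |Real.log (1 - Real.exp (-y)) - Real.log y| ≤ y := by
  have h1 := one_sub_exp_neg_pos hy
  have h2 : 1 - Real.exp (-y) ≤ y := by linarith [Real.add_one_le_exp (-y)]
  rw [abs_of_nonpos (sub_nonpos.2 (Real.log_le_log h1 h2)), neg_sub, sub_le_iff_le_add']
  have h3 : y * Real.exp (-y) ≤ 1 - Real.exp (-y) := by
    have h5 : Real.exp y * Real.exp (-y) = 1 := by rw [← Real.exp_add]; simp
    nlinarith [mul_le_mul_of_nonneg_right (Real.add_one_le_exp y) (Real.exp_pos (-y)).le]
  have h4 := Real.log_le_log (by positivity) h3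
  rw [Real.log_mul hy.ne' (Real.exp_pos _).ne', Real.log_exp] at h4
  linarith

theorem hasDerivAt_dilogExpNeg_sub {y : ℝ} (hy : 0 < y) :
    HasDerivAt (fun y => dilogExpNeg y - (y * Real.log y - y))
      (Real.log (1 - Real.exp (-y)) - Real.log y) y :=
  (hasDerivAt_dilogExpNeg hy).sub (hasDerivAt_mul_log_sub_self hy)

/-- The expansion `Li₂(exp (-y)) = π ^ 2 / 6 + y log y - y + O(y ^ 2)`. -/
theorem abs_dilogExpNeg_sub_le {y : ℝ} (hy : 0 < y) :
    |dilogExpNeg y - (y * Real.log y - y) - Real.pi ^ 2 / 6| ≤ y ^ 2 := by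
  obtain ⟨ξ, hξ, e⟩ := exists_hasDerivAt_eq_slope
    (fun y => dilogExpNeg y - (y * Real.log y - y)) _ hy
    ((continuousOn_dilogExpNeg.mono Icc_subset_Ici_self).sub
      (Real.continuous_mul_log.sub continuous_id).continuousOn)
    (fun z hz => hasDerivAt_dilogExpNeg_sub hz.1)
  rw [eq_div_iff (by linarith)] at e
  simp only [dilogExpNeg_zero, Real.log_zero, mul_zero, sub_zero] at e
  rw [← e, abs_mul, abs_of_pos hy, sq]
  gcongr
  exact (abs_log_one_sub_exp_neg_sub_log_le hξ.1).trans hξ.2.le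

theorem sum_range_average_succ (g : ℕ → ℝ) (N : ℕ) :
    ∑ r ∈ Finset.range N, (g r + g (r + 1)) / 2 =
      ∑ r ∈ Finset.range N, g r + g N / 2 - g 0 / 2 := by
  induction N with
  | zero => simp
  | succ N ih => rw [Finset.sum_range_succ, Finset.sum_range_succ, ih]; ring

/-- Partial sums of `log (1 - exp (-t (c + r)))` compared with those of `log (c + r)`, by the
trapezoidal rule applied to the convex function `log ((1 - exp (-y)) / y)`. -/
theorem abs_sum_log_one_sub_exp_neg_sub_le {t c : ℝ} (ht : 0 < t) (hc : 0 < c) (N : ℕ) :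
    |(∑ r ∈ Finset.range N, Real.log (1 - Real.exp (-(t * (c + r)))) +
          Real.log (1 - Real.exp (-(t * (c + N)))) / 2 -
          Real.log (1 - Real.exp (-(t * c))) / 2) -
        (dilogExpNeg (t * (c + N)) - dilogExpNeg (t * c)) / t -
        (∑ r ∈ Finset.range N, Real.log (c + r) + Real.log (c + N) / 2 - Real.log c / 2 -
          (((c + N) * Real.log (c + N) - (c + N)) - (c * Real.log c - c)))| ≤ t / 2 := by
  set h : ℝ → ℝ := fun y => Real.log (1 - Real.exp (-y)) - Real.log y with h_def
  set k : ℝ → ℝ := fun y => (Real.exp y - 1)⁻¹ - y⁻¹ with k_def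
  set Ψ : ℝ → ℝ := fun y => dilogExpNeg y - (y * Real.log y - y) with hΨ
  have hpos : ∀ r : ℕ, 0 < t * (c + r) := fun r => by positivity
  have hstep : ∀ r : ℕ, t * (c + (r + 1 : ℕ)) - t * (c + r) = t := fun r => by
    push_cast; ring
  have hterm : ∀ r : ℕ,
      |(h (t * (c + r)) + h (t * (c + (r + 1 : ℕ)))) / 2 * t -
          (Ψ (t * (c + (r + 1 : ℕ))) - Ψ (t * (c + r)))| ≤
        t ^ 2 / 2 * (k (t * (c + (r + 1 : ℕ))) - k (t * (c + r))) := by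
    intro r
    have hIcc : ∀ x ∈ Icc (t * (c + r)) (t * (c + (r + 1 : ℕ))), 0 < x :=
      fun x hx => (hpos r).trans_le hx.1
    have := abs_trapezoid_sub_integral_le (sub_pos.1 ((hstep r).symm ▸ ht))
      (fun x hx => hasDerivAt_dilogExpNeg_sub (hIcc x hx))
      (fun x hx => hasDerivAt_log_one_sub_exp_neg_sub_log (hIcc x hx))
      (monotoneOn_inv_exp_sub_one_sub_inv.mono hIcc)
    rwa [hstep r] at this
  have hsum := (Finset.abs_sum_le_sum_abs _ _).trans
    (Finset.sum_le_sum fun r (_ : r ∈ Finset.range N) => hterm r)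
  rw [← Finset.mul_sum, Finset.sum_range_sub (fun r : ℕ => k (t * (c + r))),
    Finset.sum_sub_distrib, Finset.sum_range_sub (fun r : ℕ => Ψ (t * (c + r))),
    ← Finset.sum_mul, sum_range_average_succ (fun r : ℕ => h (t * (c + r)))] at hsum
  have hh : ∀ r : ℕ, h (t * (c + r)) =
      Real.log (1 - Real.exp (-(t * (c + r)))) - (Real.log t + Real.log (c + r)) := fun r => by
    have : c + (r : ℝ) ≠ 0 := by positivity
    rw [h_def, ← Real.log_mul ht.ne' this]
  have hΨ' : ∀ r : ℕ, Ψ (t * (c + r)) = dilogExpNeg (t * (c + r)) -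
      t * ((c + r) * Real.log t + ((c + r) * Real.log (c + r) - (c + r))) := fun r => by
    have : c + (r : ℝ) ≠ 0 := by positivity
    simp only [hΨ]
    rw [Real.log_mul ht.ne' this]
    ring
  have hh0 := hh 0
  have hΨ0 := hΨ' 0
  rw [Nat.cast_zero, add_zero] at hh0 hΨ0
  have hk : k (t * (c + N)) - k (t * (c + (0 : ℕ))) ≤ 1 := by
    have h1 := inv_exp_sub_one_sub_inv_nonpos (hpos N)
    have h2 := neg_one_le_inv_exp_sub_one_sub_inv (hpos 0)
    simp only [k_def]
    linarith
  replace hsum := hsum.trans (mul_le_of_le_one_right (by positivity) hk)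
  simp only [hh, hΨ', Finset.sum_sub_distrib, Finset.sum_add_distrib, Finset.sum_const,
    Finset.card_range, nsmul_eq_mul, Nat.cast_zero, add_zero, hh0, hΨ0] at hsum
  refine le_of_mul_le_mul_left ?_ ht
  rw [← abs_of_pos ht, ← abs_mul, abs_of_pos ht]
  refine (le_of_eq ?_).trans (hsum.trans_eq (by ring))
  congr 1
  field_simp
  ring

theorem tendsto_log_factorial_sub :
    Tendsto (fun n : ℕ => Real.log n.factorial - (n * Real.log n - n + Real.log n / 2)) atTop
      (𝓝 (1 / 2 * Real.log (2 * Real.pi))) := by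
  have h1 : Tendsto (fun n => Real.log (Stirling.stirlingSeq n) + 1 / 2 * Real.log 2) atTop
      (𝓝 (Real.log √Real.pi + 1 / 2 * Real.log 2)) :=
    (Stirling.tendsto_stirlingSeq_sqrt_pi.log (by positivity)).add_const _
  have h2 : Real.log √Real.pi + 1 / 2 * Real.log 2 = 1 / 2 * Real.log (2 * Real.pi) := by
    rw [Real.log_sqrt Real.pi_pos.le, Real.log_mul two_ne_zero Real.pi_ne_zero]
    ring
  rw [← h2]
  refine h1.congr' ?_
  filter_upwards [eventually_ne_atTop 0] with n hn
  have hn' : (n : ℝ) ≠ 0 := Nat.cast_ne_zero.2 hn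
  rw [Stirling.log_stirlingSeq_formula, Real.log_mul two_ne_zero hn',
    Real.log_div hn' (Real.exp_pos 1).ne', Real.log_exp]
  ring

/-- Stirling's formula for the Pochhammer symbol `c (c + 1) ⋯ (c + N - 1)`. -/
theorem tendsto_sum_log_add_nat {c : ℝ} (hc : 0 < c) :
    Tendsto (fun N : ℕ => ∑ r ∈ Finset.range N, Real.log (c + r) + Real.log (c + N) / 2 -
      ((c + N) * Real.log (c + N) - (c + N))) atTop
      (𝓝 (1 / 2 * Real.log (2 * Real.pi) - Real.log (Real.Gamma c))) := by
  rw [← tendsto_add_atTop_iff_nat 1]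
  have hΓ := Real.BohrMollerup.tendsto_log_gamma hc
  have hnat : Tendsto (fun n : ℕ => (n : ℝ)) atTop atTop := tendsto_natCast_atTop_atTop
  have h1 : Tendsto (fun n : ℕ => (n : ℝ) * Real.log (1 + (c + 1) / n)) atTop (𝓝 (c + 1)) :=
    (Real.tendsto_mul_log_one_add_div_atTop (c + 1)).comp hnat
  have h2 : Tendsto (fun n : ℕ => Real.log (1 + (c + 1) / n)) atTop (𝓝 0) := by
    have : Tendsto (fun n : ℕ => 1 + (c + 1) / (n : ℝ)) atTop (𝓝 (1 + 0)) :=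
      (tendsto_const_nhds.div_atTop hnat).const_add 1
    simpa using this.log (by norm_num)
  have h3 := (((tendsto_log_factorial_sub.sub hΓ).sub h1).add
    ((h2.const_mul (-(c + 1 / 2))))).add_const (c + 1)
  have e : 1 / 2 * Real.log (2 * Real.pi) - Real.log (Real.Gamma c) - (c + 1) +
      -(c + 1 / 2) * 0 + (c + 1) =
      1 / 2 * Real.log (2 * Real.pi) - Real.log (Real.Gamma c) := by ring
  rw [e] at h3
  refine h3.congr' ?_
  filter_upwards [eventually_ne_atTop 0] with n hn
  have hn' : 0 < (n : ℝ) := Nat.cast_pos.2 (Nat.pos_of_ne_zero hn)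
  have h4 : Real.log (c + (n + 1 : ℕ)) = Real.log n + Real.log (1 + (c + 1) / n) := by
    rw [← Real.log_mul hn'.ne' (by positivity)]
    congr 1
    push_cast
    field_simp
    ring
  rw [Real.BohrMollerup.logGammaSeq, h4]
  push_cast
  ring

theorem summable_log_one_sub_exp_neg {t : ℝ} (ht : 0 < t) (c : ℝ) :
    Summable fun r : ℕ => Real.log (1 - Real.exp (-(t * (c + r)))) := by
  have h1 : Summable fun r : ℕ => -(Real.exp (-(t * c)) * Real.exp (-t) ^ r) :=
    ((summable_geometric_of_lt_one (by positivity) (by simpa using ht)).mul_left _).neg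
  convert Real.summable_log_one_add_of_summable h1 using 3 with r
  rw [← Real.exp_nat_mul, ← Real.exp_add, sub_eq_add_neg]
  ring_nf

theorem log_tprod_one_sub_exp_neg {t c : ℝ} (ht : 0 < t) (hc : 0 < c) :
    Real.log (∏' r : ℕ, (1 - Real.exp (-(t * (c + r))))) =
      ∑' r : ℕ, Real.log (1 - Real.exp (-(t * (c + r)))) := by
  rw [← Real.rexp_tsum_eq_tprod (fun r => one_sub_exp_neg_pos (by positivity))
    (summable_log_one_sub_exp_neg ht c), Real.log_exp]

theorem abs_log_tprod_one_sub_exp_neg_sub_le_of_dilogExpNeg {t c : ℝ} (ht : 0 < t)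
    (hc : 0 < c) :
    |Real.log (∏' r : ℕ, (1 - Real.exp (-(t * (c + r))))) -
        Real.log (1 - Real.exp (-(t * c))) / 2 + dilogExpNeg (t * c) / t -
        (1 / 2 * Real.log (2 * Real.pi) - Real.log (Real.Gamma c) - Real.log c / 2 +
          (c * Real.log c - c))| ≤ t / 2 := by
  rw [log_tprod_one_sub_exp_neg ht hc]
  have hsum := (summable_log_one_sub_exp_neg ht c).hasSum.tendsto_sum_nat
  have harg : Tendsto (fun N : ℕ => t * (c + N)) atTop atTop :=
    (tendsto_atTop_add_const_left _ _ tendsto_natCast_atTop_atTop).const_mul_atTop ht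
  have hlog := (summable_log_one_sub_exp_neg ht c).tendsto_atTop_zero
  have hdilog := tendsto_dilogExpNeg_atTop.comp harg
  have hlim := ((((hsum.add (hlog.div_const 2)).sub_const
    (Real.log (1 - Real.exp (-(t * c))) / 2)).sub
    ((hdilog.sub_const (dilogExpNeg (t * c))).div_const t)).sub
    (((tendsto_sum_log_add_nat hc).sub_const (Real.log c / 2)).add_const
      (c * Real.log c - c))).abs
  refine le_of_eq_of_le ?_ (le_of_tendsto hlim (.of_forall fun N => le_of_eq_of_le ?_
    (abs_sum_log_one_sub_exp_neg_sub_le ht hc N)))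
  · congr 1
    ring
  · congr 1
    simp only [Function.comp_apply]
    ring

/-- An explicit form of the asymptotic expansion of `∏ (1 - exp (-t (c + r)))` as `t → 0`. -/
theorem abs_log_tprod_one_sub_exp_neg_sub_le {t c : ℝ} (ht : 0 < t) (hc : 0 < c) :
    |Real.log (∏' r : ℕ, (1 - Real.exp (-(t * (c + r))))) -
        (-(Real.pi ^ 2 / (6 * t)) + (1 / 2 - c) * Real.log t +
          1 / 2 * Real.log (2 * Real.pi) - Real.log (Real.Gamma c))| ≤
      (1 / 2 + c / 2 + c ^ 2) * t := by
  have h1 := abs_log_tprod_one_sub_exp_neg_sub_le_of_dilogExpNeg ht hc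
  have h2 := abs_log_one_sub_exp_neg_sub_log_le (mul_pos ht hc)
  have h3 := abs_dilogExpNeg_sub_le (mul_pos ht hc)
  rw [Real.log_mul ht.ne' hc.ne'] at h2 h3
  have h4 : |(dilogExpNeg (t * c) - (t * c * (Real.log t + Real.log c) - t * c) -
      Real.pi ^ 2 / 6) / t| ≤ c ^ 2 * t := by
    rw [abs_div, abs_of_pos ht, div_le_iff₀ ht]
    linarith
  have h5 : (dilogExpNeg (t * c) - (t * c * (Real.log t + Real.log c) - t * c) -
      Real.pi ^ 2 / 6) / t = dilogExpNeg (t * c) / t - (c * (Real.log t + Real.log c) - c) -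
      Real.pi ^ 2 / (6 * t) := by
    field_simp
  rw [h5] at h4
  rw [abs_le] at *
  constructor <;> linarith


/-- Ramanujan-type asymptotics: as `q → 1⁻`,
`log (q^a : q^b)_∞ = π²/(6b log q) + (1/2 - a/b)(log(-log q) + log b) + (1/2)log(2π)
 - log Γ(a/b) + O(log q)`. -/
theorem qPochhammer_asymptotics (a b : ℝ) (ha : 0 < a) (hb : 0 < b) :
    (fun q : ℝ =>
        Real.log (∏' r : ℕ, (1 - q ^ (a + r * b))) -
          (Real.pi ^ 2 / (6 * b * Real.log q) +
            (1 / 2 - a / b) * (Real.log (-Real.log q) + Real.log b) +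
            (1 / 2) * Real.log (2 * Real.pi) - Real.log (Real.Gamma (a / b))))
      =O[nhdsWithin 1 (Set.Ioo (0 : ℝ) 1)] (fun q : ℝ => Real.log q) := by
  refine Asymptotics.IsBigO.of_bound ((1 / 2 + a / b / 2 + (a / b) ^ 2) * b) ?_
  filter_upwards [self_mem_nhdsWithin] with q hq
  have hlog : Real.log q < 0 := Real.log_neg hq.1 hq.2
  have ht : 0 < b * -Real.log q := mul_pos hb (neg_pos.2 hlog)
  have hterm : ∀ r : ℕ,
      q ^ (a + r * b) = Real.exp (-(b * -Real.log q * (a / b + r))) := fun r => by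
    rw [Real.rpow_def_of_pos hq.1]
    congr 1
    field_simp
  have hmain := abs_log_tprod_one_sub_exp_neg_sub_le ht (div_pos ha hb)
  rw [Real.log_mul hb.ne' (neg_pos.2 hlog).ne'] at hmain
  simp only [hterm, Real.norm_eq_abs, abs_of_neg hlog]
  refine le_of_eq_of_le ?_ (hmain.trans_eq (by ring))
  congr 2
  have : Real.pi ^ 2 / (6 * b * Real.log q) = -(Real.pi ^ 2 / (6 * (b * -Real.log q))) := by
    have := hlog.ne
    field_simp
  rw [this]
  ring
end

section
/- For a, b positive reals, as q → 1⁻ one has log[ (q^a : q^{a+b})_∞ · (q^b : q^{a+b})_∞ ] = π²/(3(a+b) log q) + log( 2 sin(aπ/(a+b)) ) + O(log q). In particular, taking a = 2, b = 3: log ( 1/((q²:q⁵)_∞ (q³:q⁵)_∞) ) = -π²/(15 log q) - (1/2) log((5+√5)/2) + O(log q), and taking a = 1, b = 4: log ( 1/((q:q⁵)_∞ (q⁴:q⁵)_∞) ) = -π²/(15 log q) - (1/2) log((5-√5)/2) + O(log q). -/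
open Filter Topology

/-- The logarithm of `(1 - e⁻ᵘ) / u`, which takes the (continuous) value `0` at `u = 0`. -/
noncomputable def logOneSubExpDiv (u : ℝ) : ℝ := Real.log ((1 - Real.exp (-u)) / u)

lemma mul_exp_neg_half_le_one_sub_exp_neg {u : ℝ} (hu : 0 ≤ u) :
    u * Real.exp (-u / 2) ≤ 1 - Real.exp (-u) := by
  have h : u / 2 ≤ Real.sinh (u / 2) := Real.self_le_sinh_iff.2 (by positivity)
  rw [Real.sinh_eq] at h
  have h1 : Real.exp (u / 2) * Real.exp (-u / 2) = 1 := by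
    rw [← Real.exp_add]; simp [neg_div]
  have h2 : Real.exp (-(u / 2)) * Real.exp (-u / 2) = Real.exp (-u) := by
    rw [← Real.exp_add]; ring_nf
  have h3 := mul_le_mul_of_nonneg_right h (Real.exp_pos (-u / 2)).le
  rw [div_mul_eq_mul_div, div_mul_eq_mul_div, sub_mul, h1, h2] at h3
  linarith

lemma one_sub_exp_neg_pos_s19 {u : ℝ} (hu : 0 < u) : 0 < 1 - Real.exp (-u) := by
  have : Real.exp (-u) < 1 := by simpa using hu
  linarith

lemma logOneSubExpDiv_nonpos {u : ℝ} (hu : 0 ≤ u) : logOneSubExpDiv u ≤ 0 := by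
  apply Real.log_nonpos
  · exact div_nonneg (by simpa using hu) hu
  · exact div_le_one_of_le₀ (by linarith [Real.add_one_le_exp (-u)]) hu

lemma neg_half_le_logOneSubExpDiv {u : ℝ} (hu : 0 ≤ u) : -u / 2 ≤ logOneSubExpDiv u := by
  rcases hu.eq_or_lt with rfl | hu
  · simp [logOneSubExpDiv]
  · rw [logOneSubExpDiv, Real.le_log_iff_exp_le (div_pos (one_sub_exp_neg_pos_s19 hu) hu),
      le_div_iff₀ hu, mul_comm]
    exact mul_exp_neg_half_le_one_sub_exp_neg hu.le

lemma log_one_sub_exp_neg {u : ℝ} (hu : 0 < u) :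
    Real.log (1 - Real.exp (-u)) = Real.log u + logOneSubExpDiv u := by
  rw [logOneSubExpDiv, Real.log_div (one_sub_exp_neg_pos_s19 hu).ne' hu.ne']
  ring

lemma hasDerivAt_logOneSubExpDiv {u : ℝ} (hu : 0 < u) :
    HasDerivAt logOneSubExpDiv (Real.exp (-u) / (1 - Real.exp (-u)) - 1 / u) u := by
  have h1 : HasDerivAt (fun v : ℝ => Real.log (1 - Real.exp (-v)) - Real.log v)
      (Real.exp (-u) / (1 - Real.exp (-u)) - 1 / u) u := by
    have h := (((hasDerivAt_id u).neg.exp.const_sub 1).log (one_sub_exp_neg_pos_s19 hu).ne').sub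
      ((hasDerivAt_id u).log hu.ne')
    refine (HasDerivAt.congr_of_eventuallyEq h ?_).congr_deriv (by simp)
    exact Eventually.of_forall fun v => by simp
  refine h1.congr_of_eventuallyEq ?_
  filter_upwards [lt_mem_nhds hu] with v hv
  rw [log_one_sub_exp_neg hv]
  ring

lemma continuousOn_logOneSubExpDiv : ContinuousOn logOneSubExpDiv (Set.Ici 0) := by
  intro u hu
  rcases (Set.mem_Ici.1 hu).eq_or_lt with rfl | hu
  · have h0 : logOneSubExpDiv 0 = 0 := by simp [logOneSubExpDiv]
    rw [ContinuousWithinAt, h0]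
    refine tendsto_of_tendsto_of_tendsto_of_le_of_le' (g := fun u : ℝ => -u / 2) (h := fun _ => 0)
      ?_ tendsto_const_nhds ?_ ?_
    · have : Continuous fun u : ℝ => -u / 2 := by fun_prop
      exact (this.tendsto' 0 0 (by simp)).mono_left nhdsWithin_le_nhds
    · filter_upwards [self_mem_nhdsWithin] with v hv using neg_half_le_logOneSubExpDiv hv
    · filter_upwards [self_mem_nhdsWithin] with v hv using logOneSubExpDiv_nonpos hv
  · exact (hasDerivAt_logOneSubExpDiv hu).continuousAt.continuousWithinAt

lemma antitoneOn_logOneSubExpDiv : AntitoneOn logOneSubExpDiv (Set.Ici 0) := by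
  refine antitoneOn_of_deriv_nonpos (convex_Ici 0) continuousOn_logOneSubExpDiv ?_ ?_
  · rw [interior_Ici]
    exact fun u hu => (hasDerivAt_logOneSubExpDiv hu).differentiableAt.differentiableWithinAt
  · rw [interior_Ici]
    intro u hu
    have hu : 0 < u := hu
    rw [(hasDerivAt_logOneSubExpDiv hu).deriv, sub_nonpos,
      div_le_div_iff₀ (one_sub_exp_neg_pos_s19 hu) hu]
    have h := mul_le_mul_of_nonneg_left (Real.add_one_le_exp u) (Real.exp_pos (-u)).le
    rw [← Real.exp_add, neg_add_cancel, Real.exp_zero] at h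
    linarith

lemma convexOn_logOneSubExpDiv : ConvexOn ℝ (Set.Ici 0) logOneSubExpDiv := by
  refine convexOn_of_hasDerivWithinAt2_nonneg (convex_Ici 0) continuousOn_logOneSubExpDiv
    (f' := fun u => Real.exp (-u) / (1 - Real.exp (-u)) - 1 / u)
    (f'' := fun u => 1 / u ^ 2 - Real.exp (-u) / (1 - Real.exp (-u)) ^ 2) ?_ ?_ ?_
  · rw [interior_Ici]
    exact fun u hu => (hasDerivAt_logOneSubExpDiv hu).hasDerivWithinAt
  · rw [interior_Ici]
    intro u hu
    have hu : 0 < u := hu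
    have h1 := one_sub_exp_neg_pos_s19 hu
    have he := (hasDerivAt_id u).neg.exp
    have h := (he.div (he.const_sub 1) h1.ne').sub ((hasDerivAt_id u).inv hu.ne')
    have h' := h.congr_deriv (g' := 1 / u ^ 2 - Real.exp (-u) / (1 - Real.exp (-u)) ^ 2) (by
      simp only [id, Pi.neg_apply]
      ring)
    refine (HasDerivAt.congr_of_eventuallyEq h' ?_).hasDerivWithinAt
    exact Eventually.of_forall fun v => by simp
  · rw [interior_Ici]
    intro u hu
    have hu : 0 < u := hu
    have h1 := one_sub_exp_neg_pos_s19 hu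
    rw [sub_nonneg, div_le_div_iff₀ (by positivity) (by positivity), one_mul]
    have h := pow_le_pow_left₀ (by positivity) (mul_exp_neg_half_le_one_sub_exp_neg hu.le) 2
    rw [mul_pow, ← Real.exp_nat_mul] at h
    convert h using 1
    rw [mul_comm]
    congr 2
    push_cast
    ring

/-- Comparison of symmetric pairs of values of a convex function. -/
lemma ConvexOn.map_add_map_le_of_add_eq {s : Set ℝ} {f : ℝ → ℝ} (hf : ConvexOn ℝ s f)
    {p q x y : ℝ} (hp : p ∈ s) (hq : q ∈ s) (hpx : p ≤ x) (hxq : x ≤ q) (h : x + y = p + q) :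
    f x + f y ≤ f p + f q := by
  rcases (hpx.trans hxq).eq_or_lt with rfl | hpq
  · obtain rfl : x = p := le_antisymm hxq hpx
    obtain rfl : y = x := by linarith
    rfl
  · have hd : 0 < q - p := sub_pos.2 hpq
    have h1 : 0 ≤ (q - x) / (q - p) := div_nonneg (by linarith) hd.le
    have h2 : 0 ≤ (x - p) / (q - p) := div_nonneg (by linarith) hd.le
    have h3 : (q - x) / (q - p) + (x - p) / (q - p) = 1 := by field_simp; ring
    have hx := hf.2 hp hq h1 h2 h3
    have hy := hf.2 hp hq h2 h1 (by rw [add_comm, h3])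
    simp only [smul_eq_mul] at hx hy
    have ex : (q - x) / (q - p) * p + (x - p) / (q - p) * q = x := by field_simp; ring
    have ey : (x - p) / (q - p) * p + (q - x) / (q - p) * q = y := by
      rw [show y = p + q - x by linarith]; field_simp; ring
    rw [ex] at hx
    rw [ey] at hy
    have : (q - x) / (q - p) * f p + (x - p) / (q - p) * f q +
        ((x - p) / (q - p) * f p + (q - x) / (q - p) * f q) = f p + f q := by
      linear_combination (f p + f q) * h3
    linarith

/-- The sum of second differences of `logOneSubExpDiv` around the points `t (r + 1/2)`. -/
lemma sum_logOneSubExpDiv_sub_mem_Icc {t x : ℝ} (ht : 0 < t) (hx0 : 0 < x) (hx1 : x < 1) (n : ℕ) :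
    ∑ r ∈ Finset.range n, (logOneSubExpDiv (t * (r + x)) + logOneSubExpDiv (t * (r + (1 - x))) -
      2 * logOneSubExpDiv (t * (r + 1 / 2))) ∈ Set.Icc 0 (t / 4) := by
  constructor
  · refine Finset.sum_nonneg fun r _ => ?_
    have hr : (0 : ℝ) ≤ r := r.cast_nonneg
    have hy : t * (r + (1 - x)) ∈ Set.Ici (0 : ℝ) :=
      mul_nonneg ht.le (by linarith)
    have hx : t * (r + x) ∈ Set.Ici (0 : ℝ) := mul_nonneg ht.le (by linarith)
    have h := convexOn_logOneSubExpDiv.2 hx hy (by norm_num : (0 : ℝ) ≤ 1 / 2)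
      (by norm_num : (0 : ℝ) ≤ 1 / 2) (by norm_num)
    simp only [smul_eq_mul] at h
    rw [show 1 / 2 * (t * (r + x)) + 1 / 2 * (t * (r + (1 - x))) = t * (r + 1 / 2) by ring] at h
    linarith
  · let o : ℕ → ℝ := fun r => logOneSubExpDiv (t * (r + 1 / 2)) - logOneSubExpDiv (t * r)
    have hsum : ∑ r ∈ Finset.range n,
        (logOneSubExpDiv (t * (r + x)) + logOneSubExpDiv (t * (r + (1 - x))) -
          2 * logOneSubExpDiv (t * (r + 1 / 2))) ≤ ∑ r ∈ Finset.range n, (o (r + 1) - o r) := by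
      refine Finset.sum_le_sum fun r _ => ?_
      have hr : (0 : ℝ) ≤ r := r.cast_nonneg
      have h0 : t * r ∈ Set.Ici (0 : ℝ) := mul_nonneg ht.le hr
      have h1 : t * (r + 1) ∈ Set.Ici (0 : ℝ) := mul_nonneg ht.le (by linarith)
      have h2 : t * (r + 1 / 2) ∈ Set.Ici (0 : ℝ) := mul_nonneg ht.le (by linarith)
      have h3 : t * (r + 1 + 1 / 2) ∈ Set.Ici (0 : ℝ) := mul_nonneg ht.le (by linarith)
      have hA := convexOn_logOneSubExpDiv.map_add_map_le_of_add_eq (x := t * (r + x))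
        (y := t * (r + (1 - x))) h0 h1 (by gcongr; linarith) (by gcongr) (by ring)
      have hB := convexOn_logOneSubExpDiv.map_add_map_le_of_add_eq (x := t * (r + 1))
        (y := t * (r + 1)) h2 h3 (mul_le_mul_of_nonneg_left (by linarith) ht.le)
        (mul_le_mul_of_nonneg_left (by linarith) ht.le) (by ring)
      simp only [o]
      push_cast
      linarith
    rw [Finset.sum_range_sub] at hsum
    have hn : o n ≤ 0 := sub_nonpos.2 (antitoneOn_logOneSubExpDiv
      (mul_nonneg ht.le n.cast_nonneg) (Set.mem_Ici.2 (by positivity)) (by gcongr; norm_num))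
    have h0 : -(t / 4) ≤ o 0 := by
      have := neg_half_le_logOneSubExpDiv (u := t * (1 / 2)) (by positivity)
      have e0 : logOneSubExpDiv 0 = 0 := by simp [logOneSubExpDiv]
      simp only [o, Nat.cast_zero, zero_add, mul_zero, e0]
      linarith
    linarith

lemma tendsto_sum_log_sin {x : ℝ} (hx0 : 0 < x) (hx1 : x < 1) :
    Tendsto (fun n : ℕ => ∑ r ∈ Finset.range n,
      (Real.log (r + x) + Real.log (r + (1 - x)) - 2 * Real.log (r + 1 / 2))) atTop
      (𝓝 (Real.log (Real.sin (Real.pi * x)))) := by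
  rw [← tendsto_add_atTop_iff_nat 1]
  have hg1 := Real.BohrMollerup.tendsto_log_gamma hx0
  have hg2 := Real.BohrMollerup.tendsto_log_gamma (sub_pos.2 hx1)
  have hg3 := Real.BohrMollerup.tendsto_log_gamma (x := 1 / 2) (by norm_num)
  have hs : 0 < Real.sin (Real.pi * x) :=
    Real.sin_pos_of_pos_of_lt_pi (by positivity) (by nlinarith [Real.pi_pos])
  have hG : Real.log (Real.Gamma x) + Real.log (Real.Gamma (1 - x)) =
      Real.log Real.pi - Real.log (Real.sin (Real.pi * x)) := by
    rw [← Real.log_mul (Real.Gamma_pos_of_pos hx0).ne'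
      (Real.Gamma_pos_of_pos (sub_pos.2 hx1)).ne', Real.Gamma_mul_Gamma_one_sub,
      Real.log_div Real.pi_pos.ne' hs.ne']
  have hhalf : Real.log (Real.Gamma (1 / 2)) = Real.log Real.pi / 2 := by
    rw [Real.Gamma_one_half_eq, Real.log_sqrt Real.pi_pos.le]
  have h := ((hg3.const_mul 2).sub hg1).sub hg2
  convert h using 1
  · ext n
    simp only [Real.BohrMollerup.logGammaSeq, Finset.sum_sub_distrib, Finset.sum_add_distrib,
      ← Finset.mul_sum, add_comm]
    ring
  · congr 1
    linear_combination hG - 2 * hhalf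

lemma summable_exp_neg_mul_natCast_add {t : ℝ} (ht : 0 < t) (x : ℝ) :
    Summable fun r : ℕ => Real.exp (-(t * (r + x))) := by
  have h : Summable fun r : ℕ => Real.exp (-(t * x)) * Real.exp (-t) ^ r :=
    (summable_geometric_of_lt_one (Real.exp_pos _).le (by simpa using ht)).mul_left _
  refine h.congr fun r => ?_
  rw [← Real.exp_nat_mul, ← Real.exp_add]
  ring_nf

/-- The logarithm of the infinite product `∏ (1 - q ^ (r + x))` at `q = exp (-t)`. -/
noncomputable def logQPochhammer (x t : ℝ) : ℝ :=
  ∑' r : ℕ, Real.log (1 - Real.exp (-(t * (r + x))))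

lemma summable_log_one_sub_exp {t : ℝ} (ht : 0 < t) (x : ℝ) :
    Summable fun r : ℕ => Real.log (1 - Real.exp (-(t * (r + x)))) := by
  simpa [sub_eq_add_neg] using
    Real.summable_log_one_add_of_summable (summable_exp_neg_mul_natCast_add ht x).neg

lemma logQPochhammer_sub_mem_Icc {t x : ℝ} (ht : 0 < t) (hx0 : 0 < x) (hx1 : x < 1) :
    logQPochhammer x t + logQPochhammer (1 - x) t - 2 * logQPochhammer (1 / 2) t -
      Real.log (Real.sin (Real.pi * x)) ∈ Set.Icc 0 (t / 4) := by
  have h := (((summable_log_one_sub_exp ht x).hasSum.add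
    (summable_log_one_sub_exp ht (1 - x)).hasSum).sub
    ((summable_log_one_sub_exp ht (1 / 2)).hasSum.mul_left 2)).tendsto_sum_nat
  refine isClosed_Icc.mem_of_tendsto (h.sub (tendsto_sum_log_sin hx0 hx1))
    (Eventually.of_forall fun n => ?_)
  rw [← Finset.sum_sub_distrib]
  convert sum_logOneSubExpDiv_sub_mem_Icc ht hx0 hx1 n using 2 with r
  have hr : (0 : ℝ) ≤ r := r.cast_nonneg
  have h1 : 0 < r + x := by linarith
  have h2 : 0 < r + (1 - x) := by linarith
  have h3 : (0 : ℝ) < r + 1 / 2 := by linarith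
  rw [log_one_sub_exp_neg (mul_pos ht h1), log_one_sub_exp_neg (mul_pos ht h2),
    log_one_sub_exp_neg (mul_pos ht h3), Real.log_mul ht.ne' h1.ne', Real.log_mul ht.ne' h2.ne',
    Real.log_mul ht.ne' h3.ne']
  ring

lemma logQPochhammer_half {t : ℝ} (ht : 0 < t) :
    logQPochhammer (1 / 2) (t / 2) = logQPochhammer (1 / 4) t + logQPochhammer (1 - 1 / 4) t := by
  have e1 : ∀ r : ℕ, t / 2 * ((2 * r : ℕ) + 1 / 2) = t * (r + 1 / 4) := fun r => by
    push_cast; ring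
  have e2 : ∀ r : ℕ, t / 2 * ((2 * r + 1 : ℕ) + 1 / 2) = t * (r + (1 - 1 / 4)) := fun r => by
    push_cast; ring
  rw [logQPochhammer, ← tsum_even_add_odd]
  · simp only [e1, e2, logQPochhammer]
  · simpa only [e1] using summable_log_one_sub_exp ht (1 / 4)
  · simpa only [e2] using summable_log_one_sub_exp ht (1 - 1 / 4)

lemma hasSum_exp_neg_mul_natCast_add_half {v : ℝ} (hv : 0 < v) :
    HasSum (fun r : ℕ => Real.exp (-(v * (r + 1 / 2))))
      (Real.exp (-v / 2) / (1 - Real.exp (-v))) := by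
  have h := (hasSum_geometric_of_lt_one (Real.exp_pos (-v)).le (by simpa using hv)).mul_left
    (Real.exp (-v / 2))
  rw [← div_eq_mul_inv] at h
  refine h.congr_fun fun r => ?_
  rw [← Real.exp_nat_mul, ← Real.exp_add]
  ring_nf

lemma mul_exp_neg_half_div_mem_Icc {v : ℝ} (hv : 0 < v) :
    v * (Real.exp (-v / 2) / (1 - Real.exp (-v))) ∈ Set.Icc (Real.exp (-v / 2)) 1 := by
  have h := one_sub_exp_neg_pos_s19 hv
  rw [← mul_div_assoc]
  constructor
  · rw [le_div_iff₀ h, mul_comm]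
    gcongr
    linarith [Real.add_one_le_exp (-v)]
  · exact (div_le_one h).2 (mul_exp_neg_half_le_one_sub_exp_neg hv.le)

/-- The Lambert series of `logQPochhammer (1 / 2)`. -/
lemma logQPochhammer_half_eq_tsum {t : ℝ} (ht : 0 < t) :
    logQPochhammer (1 / 2) t = -∑' m : ℕ, Real.exp (-(t * (m + 1)) / 2) /
      (1 - Real.exp (-(t * (m + 1)))) / (m + 1) := by
  let f : ℕ → ℕ → ℝ := fun m r => Real.exp (-(t * (m + 1) * (r + 1 / 2))) / (m + 1)
  have hm : ∀ m : ℕ, HasSum (f m) (Real.exp (-(t * (m + 1)) / 2) /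
      (1 - Real.exp (-(t * (m + 1)))) / (m + 1)) := fun m =>
    (hasSum_exp_neg_mul_natCast_add_half (by positivity)).div_const _
  have hr : ∀ r : ℕ, HasSum (fun m => f m r) (-Real.log (1 - Real.exp (-(t * (r + 1 / 2))))) := by
    intro r
    have h := Real.hasSum_pow_div_log_of_abs_lt_one (x := Real.exp (-(t * (r + 1 / 2)))) (by
      rw [abs_of_pos (Real.exp_pos _), Real.exp_lt_one_iff]
      have : 0 < t * (r + 1 / 2) := by positivity
      linarith)
    refine h.congr_fun fun m => ?_
    simp only [f]
    rw [← Real.exp_nat_mul]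
    push_cast
    ring_nf
  have hs : Summable (Function.uncurry f) := by
    rw [summable_prod_of_nonneg (fun p => by simp only [Function.uncurry, f]; positivity)]
    refine ⟨fun m => (hm m).summable, ?_⟩
    have h2 : Summable fun m : ℕ => 1 / t * (1 / ((m : ℝ) + 1) ^ 2) := by
      refine Summable.mul_left _ ?_
      exact_mod_cast (summable_nat_add_iff 1).2 (Real.summable_one_div_nat_pow.2 one_lt_two)
    refine Summable.of_nonneg_of_le (fun m => tsum_nonneg fun r => ?_) (fun m => ?_) h2
    · simp only [Function.uncurry, f]; positivity
    · simp only [Function.uncurry]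
      rw [(hm m).tsum_eq]
      have hv : 0 < t * ((m : ℝ) + 1) := by positivity
      have h := (mul_exp_neg_half_div_mem_Icc hv).2
      rw [← le_div_iff₀' hv] at h
      calc _ ≤ 1 / (t * ((m : ℝ) + 1)) / (m + 1) := by gcongr
        _ = _ := by field_simp
  have h := Summable.tsum_comm' hs (fun m => (hm m).summable) (fun r => (hr r).summable)
  simp only [(hm _).tsum_eq, (hr _).tsum_eq, tsum_neg] at h
  rw [logQPochhammer, ← h, neg_neg]

lemma tendsto_mul_logQPochhammer_half :
    Tendsto (fun t : ℝ => t * logQPochhammer (1 / 2) t) (𝓝[>] 0) (𝓝 (-(Real.pi ^ 2 / 6))) := by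
  have hz : HasSum (fun m : ℕ => 1 / ((m : ℝ) + 1) ^ 2) (Real.pi ^ 2 / 6) := by
    have h := (hasSum_nat_add_iff' 1).2 hasSum_zeta_two
    simpa using h
  rw [← hz.tsum_eq]
  have key : Tendsto (fun t : ℝ => ∑' m : ℕ, t * (m + 1) * (Real.exp (-(t * (m + 1)) / 2) /
      (1 - Real.exp (-(t * (m + 1))))) * (1 / ((m : ℝ) + 1) ^ 2)) (𝓝[>] 0)
      (𝓝 (∑' m : ℕ, 1 / ((m : ℝ) + 1) ^ 2)) := by
    refine tendsto_tsum_of_dominated_convergence hz.summable (fun m => ?_) ?_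
    · rw [← one_mul (1 / ((m : ℝ) + 1) ^ 2)]
      refine Tendsto.mul ?_ (by simp)
      have hc : Continuous fun t : ℝ => Real.exp (-(t * (m + 1)) / 2) := by fun_prop
      refine tendsto_of_tendsto_of_tendsto_of_le_of_le'
        ((hc.tendsto' 0 1 (by simp)).mono_left nhdsWithin_le_nhds) tendsto_const_nhds ?_ ?_
      all_goals
        filter_upwards [self_mem_nhdsWithin] with t ht
        have ht : 0 < t := ht
      · exact (mul_exp_neg_half_div_mem_Icc (by positivity)).1
      · exact (mul_exp_neg_half_div_mem_Icc (by positivity)).2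
    · filter_upwards [self_mem_nhdsWithin] with t ht m
      have ht : 0 < t := ht
      have h := mul_exp_neg_half_div_mem_Icc (v := t * (m + 1)) (by positivity)
      rw [norm_mul, Real.norm_of_nonneg ((Real.exp_pos _).le.trans h.1),
        Real.norm_of_nonneg (by positivity : (0 : ℝ) ≤ 1 / ((m : ℝ) + 1) ^ 2)]
      exact mul_le_of_le_one_left (by positivity) h.2
  refine key.neg.congr' ?_
  filter_upwards [self_mem_nhdsWithin] with t ht
  rw [logQPochhammer_half_eq_tsum ht, mul_neg, ← tsum_mul_left]
  congr 1
  refine tsum_congr fun m => ?_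
  have : (m : ℝ) + 1 ≠ 0 := by positivity
  field_simp

lemma abs_logQPochhammer_half_sub_le {t : ℝ} (ht : 0 < t) :
    |2 * logQPochhammer (1 / 2) t + Real.pi ^ 2 / (3 * t) - Real.log 2| ≤ t / 3 := by
  let e : ℝ → ℝ := fun s => 2 * logQPochhammer (1 / 2) s + Real.pi ^ 2 / (3 * s) - Real.log 2
  have hstep : ∀ s, 0 < s → |e s| - s / 3 ≤ (|e (s / 2)| - s / 2 / 3) / 2 := by
    intro s hs
    have h := logQPochhammer_sub_mem_Icc hs (x := 1 / 4) (by norm_num) (by norm_num)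
    have hsin : Real.log (Real.sin (Real.pi * (1 / 4))) = -(Real.log 2 / 2) := by
      rw [mul_one_div, Real.sin_pi_div_four, Real.log_div (by simp) two_ne_zero,
        Real.log_sqrt two_pos.le]
      ring
    rw [hsin, ← logQPochhammer_half hs] at h
    have he : e (s / 2) - 2 * e s =
        2 * (logQPochhammer (1 / 2) (s / 2) - 2 * logQPochhammer (1 / 2) s -
          -(Real.log 2 / 2)) := by
      simp only [e]
      field_simp
      ring
    obtain ⟨h1, h2⟩ := h
    have h3 : |2 * e s| ≤ |e (s / 2)| + s / 2 := by
      have : |e (s / 2) - 2 * e s| ≤ s / 2 := by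
        rw [he, abs_of_nonneg (by linarith)]
        linarith
      have h4 := abs_sub_abs_le_abs_sub (2 * e s) (e (s / 2))
      rw [abs_sub_comm (2 * e s)] at h4
      linarith
    rw [abs_mul, abs_two] at h3
    linarith
  have hiter : ∀ n : ℕ, |e t| - t / 3 ≤ |e (t / 2 ^ n)| / 2 ^ n - t / 3 / 4 ^ n := by
    intro n
    induction n with
    | zero => simp
    | succ n ih =>
      have h := div_le_div_of_nonneg_right (hstep (t / 2 ^ n) (by positivity))
        (by positivity : (0 : ℝ) ≤ 2 ^ n)
      have e4 : (4 : ℝ) ^ n = 2 ^ n * 2 ^ n := by rw [← mul_pow]; norm_num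
      have el : (|e (t / 2 ^ n)| - t / 2 ^ n / 3) / 2 ^ n =
          |e (t / 2 ^ n)| / 2 ^ n - t / 3 / 4 ^ n := by
        rw [e4]; field_simp
      have er : (|e (t / 2 ^ n / 2)| - t / 2 ^ n / 2 / 3) / 2 / 2 ^ n =
          |e (t / 2 ^ (n + 1))| / 2 ^ (n + 1) - t / 3 / 4 ^ (n + 1) := by
        rw [pow_succ 4, e4, pow_succ, div_div t (2 ^ n) 2]; field_simp; ring
      linarith
  have hlim : Tendsto (fun s => s * e s) (𝓝[>] 0) (𝓝 0) := by
    have hid : Tendsto (fun s : ℝ => s) (𝓝[>] 0) (𝓝 0) := nhdsWithin_le_nhds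
    have h := ((tendsto_mul_logQPochhammer_half.const_mul 2).add_const (Real.pi ^ 2 / 3)).sub
      (hid.mul_const (Real.log 2))
    rw [show 2 * -(Real.pi ^ 2 / 6) + Real.pi ^ 2 / 3 - 0 * Real.log 2 = 0 by ring] at h
    refine h.congr' ?_
    filter_upwards [self_mem_nhdsWithin] with s hs
    have : s ≠ 0 := ne_of_gt hs
    simp only [e]
    field_simp
  have hseq : Tendsto (fun n : ℕ => t / 2 ^ n) atTop (𝓝[>] 0) := by
    refine tendsto_nhdsWithin_iff.2 ⟨?_, Eventually.of_forall fun n => Set.mem_Ioi.2 (by positivity)⟩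
    have h := (tendsto_pow_atTop_nhds_zero_of_lt_one (r := (1 / 2 : ℝ)) (by norm_num)
      (by norm_num)).const_mul t
    simpa [div_eq_mul_inv] using h
  have h0 : |e t| - t / 3 ≤ 0 := by
    have h := ((hlim.comp hseq).abs.div_const t)
    rw [abs_zero, zero_div] at h
    refine ge_of_tendsto' h fun n => (hiter n).trans ?_
    have hb : 0 ≤ t / 3 / 4 ^ n := by positivity
    have hc : |e (t / 2 ^ n)| / 2 ^ n = |t / 2 ^ n * e (t / 2 ^ n)| / t := by
      rw [abs_mul, abs_of_pos (by positivity : 0 < t / 2 ^ n)]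
      field_simp
    simp only [Function.comp]
    linarith
  linarith

/-- An explicit form of the asymptotics, with `q = exp (-t)` and base `q`. -/
lemma abs_logQPochhammer_add_sub_le {t x : ℝ} (ht : 0 < t) (hx0 : 0 < x) (hx1 : x < 1) :
    |logQPochhammer x t + logQPochhammer (1 - x) t + Real.pi ^ 2 / (3 * t) -
      Real.log (2 * Real.sin (x * Real.pi))| ≤ t := by
  have hs : 0 < Real.sin (x * Real.pi) :=
    Real.sin_pos_of_pos_of_lt_pi (by positivity) (by nlinarith [Real.pi_pos])
  obtain ⟨h1, h2⟩ := logQPochhammer_sub_mem_Icc ht hx0 hx1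
  obtain ⟨h3, h4⟩ := abs_le.1 (abs_logQPochhammer_half_sub_le ht)
  rw [mul_comm Real.pi] at h1 h2
  rw [Real.log_mul two_ne_zero hs.ne', abs_le]
  constructor <;> linarith

lemma log_tprod_one_sub_rpow {q c x : ℝ} (hq : q ∈ Set.Ioo (0 : ℝ) 1) (hc : 0 < c) (hx : 0 < x) :
    0 < ∏' r : ℕ, (1 - q ^ (c * x + r * c)) ∧
      Real.log (∏' r : ℕ, (1 - q ^ (c * x + r * c))) = logQPochhammer x (-(c * Real.log q)) := by
  have ht : 0 < -(c * Real.log q) := by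
    have := mul_neg_of_pos_of_neg hc (Real.log_neg hq.1 hq.2)
    linarith
  have hterm : ∀ r : ℕ, 1 - q ^ (c * x + r * c) =
      1 - Real.exp (-(-(c * Real.log q) * (r + x))) := fun r => by
    rw [Real.rpow_def_of_pos hq.1]
    ring_nf
  simp only [hterm]
  have h := Real.rexp_tsum_eq_tprod
    (f := fun r : ℕ => 1 - Real.exp (-(-(c * Real.log q) * (r + x))))
    (fun r => one_sub_exp_neg_pos_s19 (mul_pos ht (by positivity))) (summable_log_one_sub_exp ht x)
  rw [← h, Real.log_exp]
  exact ⟨Real.exp_pos _, rfl⟩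

lemma isBigO_log_tprod_mul_tprod {a b : ℝ} (ha : 0 < a) (hb : 0 < b) :
    (fun q : ℝ =>
        Real.log ((∏' r : ℕ, (1 - q ^ (a + r * (a + b)))) *
            (∏' r : ℕ, (1 - q ^ (b + r * (a + b))))) -
          (Real.pi ^ 2 / (3 * (a + b) * Real.log q) +
            Real.log (2 * Real.sin (a / (a + b) * Real.pi))))
      =O[𝓝[Set.Ioo (0 : ℝ) 1] 1] (fun q : ℝ => Real.log q) := by
  refine Asymptotics.IsBigO.of_bound (a + b) ?_
  filter_upwards [self_mem_nhdsWithin] with q hq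
  have hc : 0 < a + b := add_pos ha hb
  have hx0 : 0 < a / (a + b) := by positivity
  have hx1 : a / (a + b) < 1 := (div_lt_one hc).2 (by linarith)
  have hl := Real.log_neg hq.1 hq.2
  have ht : 0 < -((a + b) * Real.log q) := by
    have := mul_neg_of_pos_of_neg hc hl
    linarith
  obtain ⟨hp1, h1⟩ := log_tprod_one_sub_rpow hq hc hx0
  obtain ⟨hp2, h2⟩ := log_tprod_one_sub_rpow hq hc (sub_pos.2 hx1)
  have ea : (a + b) * (a / (a + b)) = a := by field_simp
  have eb : (a + b) * (1 - a / (a + b)) = b := by field_simp; ring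
  rw [ea] at hp1 h1
  rw [eb] at hp2 h2
  rw [Real.log_mul hp1.ne' hp2.ne', h1, h2, Real.norm_eq_abs, Real.norm_eq_abs, abs_of_neg hl]
  refine (le_of_eq ?_).trans
    ((abs_logQPochhammer_add_sub_le ht hx0 hx1).trans_eq (by ring))
  congr 1
  have : Real.log q ≠ 0 := hl.ne
  field_simp
  ring

lemma log_two_mul_sin_pi_div_five :
    Real.log (2 * Real.sin (Real.pi / 5)) = 1 / 2 * Real.log ((5 - √5) / 2) := by
  have h5 : √5 ^ 2 = 5 := Real.sq_sqrt (by norm_num)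
  have h : (2 * Real.sin (Real.pi / 5)) ^ 2 = (5 - √5) / 2 := by
    rw [mul_pow, Real.sin_sq, Real.cos_pi_div_five]
    linear_combination -(1 / 4) * h5
  rw [← h, Real.log_pow]
  push_cast
  ring

lemma log_two_mul_sin_two_pi_div_five :
    Real.log (2 * Real.sin (2 / 5 * Real.pi)) = 1 / 2 * Real.log ((5 + √5) / 2) := by
  have h5 : √5 ^ 2 = 5 := Real.sq_sqrt (by norm_num)
  have h : (2 * Real.sin (2 / 5 * Real.pi)) ^ 2 = (5 + √5) / 2 := by
    rw [show 2 / 5 * Real.pi = 2 * (Real.pi / 5) by ring, mul_pow, Real.sin_sq, Real.cos_two_mul,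
      Real.cos_pi_div_five]
    linear_combination (-(√5 ^ 2) / 16 - √5 / 4 + 5 / 16) * h5
  rw [← h, Real.log_pow]
  push_cast
  ring


/-- Ramanujan's asymptotics related to the Rogers–Ramanujan identities:
as `q → 1⁻`,
`log[(q^a : q^{a+b})_∞ (q^b : q^{a+b})_∞] = π²/(3(a+b)log q) + log(2 sin(aπ/(a+b))) + O(log q)`,
and in particular the two Rogers–Ramanujan cases `(a,b) = (2,3)` and `(a,b) = (1,4)`. -/
theorem rogersRamanujan_asymptotics (a b : ℝ) (ha : 0 < a) (hb : 0 < b) :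
    ((fun q : ℝ =>
        Real.log ((∏' r : ℕ, (1 - q ^ (a + r * (a + b)))) *
            (∏' r : ℕ, (1 - q ^ (b + r * (a + b))))) -
          (Real.pi ^ 2 / (3 * (a + b) * Real.log q) +
            Real.log (2 * Real.sin (a / (a + b) * Real.pi))))
      =O[nhdsWithin 1 (Set.Ioo (0 : ℝ) 1)] (fun q : ℝ => Real.log q)) ∧
    ((fun q : ℝ =>
        Real.log (1 / ((∏' r : ℕ, (1 - q ^ ((2 : ℝ) + r * 5))) *
            (∏' r : ℕ, (1 - q ^ ((3 : ℝ) + r * 5))))) -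
          (-Real.pi ^ 2 / (15 * Real.log q) -
            (1 / 2) * Real.log ((5 + Real.sqrt 5) / 2)))
      =O[nhdsWithin 1 (Set.Ioo (0 : ℝ) 1)] (fun q : ℝ => Real.log q)) ∧
    ((fun q : ℝ =>
        Real.log (1 / ((∏' r : ℕ, (1 - q ^ ((1 : ℝ) + r * 5))) *
            (∏' r : ℕ, (1 - q ^ ((4 : ℝ) + r * 5))))) -
          (-Real.pi ^ 2 / (15 * Real.log q) -
            (1 / 2) * Real.log ((5 - Real.sqrt 5) / 2)))
      =O[nhdsWithin 1 (Set.Ioo (0 : ℝ) 1)] (fun q : ℝ => Real.log q)) := by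
  refine ⟨isBigO_log_tprod_mul_tprod ha hb, ?_, ?_⟩
  · have h := (isBigO_log_tprod_mul_tprod (a := 2) (b := 3) two_pos three_pos).neg_left
    norm_num only at h
    rw [log_two_mul_sin_two_pi_div_five] at h
    refine h.congr_left fun q => ?_
    simp only [one_div, Real.log_inv]
    ring
  · have h := (isBigO_log_tprod_mul_tprod (a := 1) (b := 4) one_pos four_pos).neg_left
    norm_num only at h
    rw [one_div_mul_eq_div, log_two_mul_sin_pi_div_five] at h
    refine h.congr_left fun q => ?_
    simp only [one_div, Real.log_inv]
    ring
end
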